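/- arXiv:2601.01951 — 10 statements merged into one kernel-verified Lean document; each statement's English description precedes it below -/
import Mathlib

section
/- The derivative of V along trajectories of the oscillator, V̇(x, z, v) = h₂(z)f₁(z)g₁(v) + h₂(z)f₂(z)g₂(v) − v·c(x, z, v), satisfies V̇(x, z, v) ≤ 0 for all x, z, v ∈ ℝ. -/
/-- The derivative of `V` along trajectories of the oscillator,
`V̇(x,z,v) = h₂(z)f₁(z)g₁(v) + h₂(z)f₂(z)g₂(v) − v·c(x,z,v)`, is nonpositive. -/
theorem Vdot_nonpos
    (f₁ f₂ g₁ g₂ h₁ h₂ : ℝ → ℝ) (c : ℝ → ℝ → ℝ → ℝ)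
    (hf₁lip : LocallyLipschitz f₁) (hf₂lip : LocallyLipschitz f₂)
    (hg₁lip : LocallyLipschitz g₁) (hg₂lip : LocallyLipschitz g₂)
    (hh₁lip : LocallyLipschitz h₁) (hh₂lip : LocallyLipschitz h₂)
    (hh₁mono : StrictMono h₁) (hh₂mono : StrictMono h₂)
    (hf₁0 : f₁ 0 = 0) (hf₂0 : f₂ 0 = 0) (hg₁0 : g₁ 0 = 0) (hg₂0 : g₂ 0 = 0)
    (hh₁0 : h₁ 0 = 0) (hh₂0 : h₂ 0 = 0)
    (hfneg : ∀ z < (0:ℝ), 0 < f₁ z ∧ f₂ z < 0)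
    (hfpos : ∀ z > (0:ℝ), f₁ z < 0 ∧ 0 < f₂ z)
    (hgpos : ∀ v > (0:ℝ), 0 < g₁ v ∧ g₂ v = 0)
    (hgneg : ∀ v < (0:ℝ), g₁ v = 0 ∧ g₂ v < 0)
    (hclip : LocallyLipschitz (fun p : ℝ × ℝ × ℝ => c p.1 p.2.1 p.2.2))
    (hc0 : ∀ x z : ℝ, c x z 0 = 0)
    (hcv : ∀ x z v : ℝ, 0 ≤ v * c x z v)
    :
    ∀ x z v : ℝ,
      h₂ z * f₁ z * g₁ v + h₂ z * f₂ z * g₂ v - v * c x z v ≤ 0 := by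
  intro x z v
  have hf₁ : h₂ z * f₁ z ≤ 0 := by
    rcases lt_trichotomy z 0 with hz | rfl | hz
    · exact mul_nonpos_of_nonpos_of_nonneg (hh₂0 ▸ hh₂mono hz).le (hfneg z hz).1.le
    · simp [hh₂0]
    · exact mul_nonpos_of_nonneg_of_nonpos (hh₂0 ▸ hh₂mono hz).le (hfpos z hz).1.le
  have hf₂ : 0 ≤ h₂ z * f₂ z := by
    rcases lt_trichotomy z 0 with hz | rfl | hz
    · exact mul_nonneg_of_nonpos_of_nonpos (hh₂0 ▸ hh₂mono hz).le (hfneg z hz).2.le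
    · simp [hh₂0]
    · exact mul_nonneg (hh₂0 ▸ hh₂mono hz).le (hfpos z hz).2.le
  have hg : 0 ≤ g₁ v ∧ g₂ v ≤ 0 := by
    rcases lt_trichotomy v 0 with hv | rfl | hv
    · exact ⟨(hgneg v hv).1.ge, (hgneg v hv).2.le⟩
    · exact ⟨hg₁0.ge, hg₂0.le⟩
    · exact ⟨(hgpos v hv).1.le, (hgpos v hv).2.le⟩
  linarith [mul_nonpos_of_nonpos_of_nonneg hf₁ hg.1,
    mul_nonpos_of_nonneg_of_nonpos hf₂ hg.2, hcv x z v]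
end

section
/- The solutions of the oscillator are equibounded: for every α > 0 there exists β > 0 such that for every solution (x, z, v) : [0, T) → ℝ³ of the oscillator (T ∈ (0, +∞]) with ‖(x(0), z(0), v(0))‖₂ ≤ α, it holds that ‖(x(t), z(t), v(t))‖₂ < β for all t ∈ [0, T). -/
open intervalIntegral in
/-- The tangent line inequality for the primitive of a monotone continuous function. -/
theorem mul_sub_le_integral_of_monotone {h : ℝ → ℝ} (hc : Continuous h) (hm : Monotone h)
    (a b : ℝ) : h a * (b - a) ≤ ∫ s in a..b, h s := by
  rcases le_total a b with hab | hab
  · have := integral_mono_on hab (intervalIntegrable_const (c := h a) (μ := MeasureTheory.volume))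
      (hc.intervalIntegrable a b) (fun s hs => hm hs.1)
    rw [integral_const, smul_eq_mul] at this
    linarith
  · have := integral_mono_on hab (hc.intervalIntegrable b a)
      (intervalIntegrable_const (c := h a) (μ := MeasureTheory.volume)) (fun s hs => hm hs.2)
    rw [integral_const, smul_eq_mul] at this
    rw [integral_symm]
    linarith

theorem integral_nonneg_of_monotone {h : ℝ → ℝ} (hc : Continuous h) (hm : Monotone h)
    (h0 : h 0 = 0) (y : ℝ) : 0 ≤ ∫ s in (0:ℝ)..y, h s := by
  simpa [h0] using mul_sub_le_integral_of_monotone hc hm 0 y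

theorem integral_le_of_monotone {h : ℝ → ℝ} (hc : Continuous h) (hm : Monotone h)
    (h0 : h 0 = 0) {α y : ℝ} (hy : |y| ≤ α) :
    ∫ s in (0:ℝ)..y, h s ≤ α * (h α - h (-α)) := by
  have hα : 0 ≤ α := (abs_nonneg y).trans hy
  obtain ⟨hy₁, hy₂⟩ := abs_le.mp hy
  have key := mul_sub_le_integral_of_monotone hc hm y 0
  rw [intervalIntegral.integral_symm] at key
  have h₁ := hm hy₁
  have h₂ := hm hy₂
  have h₃ := hm (neg_nonpos.mpr hα)
  have h₄ := hm hα
  rw [h0] at h₃ h₄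
  rcases le_total 0 y with hy0 | hy0
  · have h₅ := hm hy0
    rw [h0] at h₅
    nlinarith [mul_le_mul h₂ hy₂ hy0 h₄, mul_nonneg hα (neg_nonneg.mpr h₃)]
  · have h₅ := hm hy0
    rw [h0] at h₅
    nlinarith [mul_le_mul (neg_le_neg h₁) (neg_le.mp hy₁) (neg_nonneg.mpr hy0)
      (neg_nonneg.mpr h₃), mul_nonneg hα h₄]

/-- Sublevel sets of the primitive of a strictly increasing function vanishing at `0` are
bounded. -/
theorem abs_le_of_integral_le {h : ℝ → ℝ} (hc : Continuous h) (hm : StrictMono h)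
    (h0 : h 0 = 0) {M y : ℝ} (hy : ∫ s in (0:ℝ)..y, h s ≤ M) :
    |y| ≤ 1 + M / h 1 + M / -h (-1) := by
  have hp : 0 < h 1 := h0 ▸ hm one_pos
  have hn : 0 < -h (-1) := by
    have : h (-1) < h 0 := hm (by norm_num)
    linarith
  have hM : 0 ≤ M := (integral_nonneg_of_monotone hc hm.monotone h0 y).trans hy
  have split (a : ℝ) : h a * (y - a) ≤ M := by
    have hadd := intervalIntegral.integral_add_adjacent_intervals
      (hc.intervalIntegrable (μ := MeasureTheory.volume) 0 a) (hc.intervalIntegrable a y)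
    linarith [mul_sub_le_integral_of_monotone hc hm.monotone a y,
      integral_nonneg_of_monotone hc hm.monotone h0 a]
  have h₁ : y - 1 ≤ M / h 1 := (le_div_iff₀' hp).mpr (split 1)
  have h₂ : -y - 1 ≤ M / -h (-1) := (le_div_iff₀' hn).mpr (by linarith [split (-1)])
  have h₃ : 0 ≤ M / h 1 := by positivity
  have h₄ : 0 ≤ M / -h (-1) := by positivity
  exact abs_le.mpr ⟨by linarith, by linarith⟩

/-- The solutions of the oscillator are equibounded: for every `α > 0` there is
`β > 0` bounding the Euclidean norm of every solution on `[0, T)`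
(`T ∈ (0, +∞]`) starting with norm at most `α`. -/
theorem solutions_equibounded
    (f₁ f₂ g₁ g₂ h₁ h₂ : ℝ → ℝ) (c : ℝ → ℝ → ℝ → ℝ)
    (hf₁lip : LocallyLipschitz f₁) (hf₂lip : LocallyLipschitz f₂)
    (hg₁lip : LocallyLipschitz g₁) (hg₂lip : LocallyLipschitz g₂)
    (hh₁lip : LocallyLipschitz h₁) (hh₂lip : LocallyLipschitz h₂)
    (hh₁mono : StrictMono h₁) (hh₂mono : StrictMono h₂)
    (hf₁0 : f₁ 0 = 0) (hf₂0 : f₂ 0 = 0) (hg₁0 : g₁ 0 = 0) (hg₂0 : g₂ 0 = 0)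
    (hh₁0 : h₁ 0 = 0) (hh₂0 : h₂ 0 = 0)
    (hfneg : ∀ z < (0:ℝ), 0 < f₁ z ∧ f₂ z < 0)
    (hfpos : ∀ z > (0:ℝ), f₁ z < 0 ∧ 0 < f₂ z)
    (hgpos : ∀ v > (0:ℝ), 0 < g₁ v ∧ g₂ v = 0)
    (hgneg : ∀ v < (0:ℝ), g₁ v = 0 ∧ g₂ v < 0)
    (hclip : LocallyLipschitz (fun p : ℝ × ℝ × ℝ => c p.1 p.2.1 p.2.2))
    (hc0 : ∀ x z : ℝ, c x z 0 = 0)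
    (hcv : ∀ x z v : ℝ, 0 ≤ v * c x z v)
    :
    ∀ α > (0:ℝ), ∃ β > (0:ℝ),
      ∀ T : WithTop ℝ, 0 < T →
      ∀ x z v : ℝ → ℝ,
      (∀ t : ℝ, 0 ≤ t → (t : WithTop ℝ) < T →
        HasDerivWithinAt x (v t) {s : ℝ | 0 ≤ s ∧ (s : WithTop ℝ) < T} t) →
      (∀ t : ℝ, 0 ≤ t → (t : WithTop ℝ) < T →
        HasDerivWithinAt z (v t + f₁ (z t) * g₁ (v t) + f₂ (z t) * g₂ (v t))
          {s : ℝ | 0 ≤ s ∧ (s : WithTop ℝ) < T} t) →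
      (∀ t : ℝ, 0 ≤ t → (t : WithTop ℝ) < T →
        HasDerivWithinAt v (-h₁ (x t) - h₂ (z t) - c (x t) (z t) (v t))
          {s : ℝ | 0 ≤ s ∧ (s : WithTop ℝ) < T} t) →
      Real.sqrt ((x 0) ^ 2 + (z 0) ^ 2 + (v 0) ^ 2) ≤ α →
      ∀ t : ℝ, 0 ≤ t → (t : WithTop ℝ) < T →
        Real.sqrt ((x t) ^ 2 + (z t) ^ 2 + (v t) ^ 2) < β := by
  intro α hα
  have hc₁ := hh₁lip.continuous
  have hc₂ := hh₂lip.continuous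
  have damping (z v : ℝ) : h₂ z * (f₁ z * g₁ v + f₂ z * g₂ v) ≤ 0 := by
    have hg : 0 ≤ g₁ v ∧ g₂ v ≤ 0 := by
      rcases lt_trichotomy v 0 with hv | rfl | hv
      · exact ⟨(hgneg v hv).1.ge, (hgneg v hv).2.le⟩
      · exact ⟨hg₁0.ge, hg₂0.le⟩
      · exact ⟨(hgpos v hv).1.le, (hgpos v hv).2.le⟩
    rcases lt_trichotomy z 0 with hz | rfl | hz
    · have hh : h₂ z ≤ 0 := hh₂0 ▸ (hh₂mono hz).le
      exact mul_nonpos_of_nonpos_of_nonneg hh (add_nonneg (mul_nonneg (hfneg z hz).1.le hg.1)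
        (mul_nonneg_of_nonpos_of_nonpos (hfneg z hz).2.le hg.2))
    · simp [hh₂0]
    · have hh : 0 ≤ h₂ z := hh₂0 ▸ (hh₂mono hz).le
      exact mul_nonpos_of_nonneg_of_nonpos hh (add_nonpos
        (mul_nonpos_of_nonpos_of_nonneg (hfpos z hz).1.le hg.1)
        (mul_nonpos_of_nonneg_of_nonpos (hfpos z hz).2.le hg.2))
  set M : ℝ := α * (h₁ α - h₁ (-α)) + α * (h₂ α - h₂ (-α)) + α ^ 2 / 2 with hM
  have hM0 : 0 ≤ M := by
    have h₁' := hh₁mono.monotone (by linarith : -α ≤ α)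
    have h₂' := hh₂mono.monotone (by linarith : -α ≤ α)
    have := mul_nonneg hα.le (sub_nonneg.mpr h₁')
    have := mul_nonneg hα.le (sub_nonneg.mpr h₂')
    positivity
  have bound_pos {h : ℝ → ℝ} (hm : StrictMono h) (h0 : h 0 = 0) :
      0 ≤ M / h 1 + M / -h (-1) := by
    have hp : h 0 < h 1 := hm one_pos
    have hn : h (-1) < h 0 := hm (by norm_num)
    rw [h0] at hp hn
    have : 0 < -h (-1) := by linarith
    positivity
  have hb₁ := bound_pos hh₁mono hh₁0
  have hb₂ := bound_pos hh₂mono hh₂0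
  refine ⟨(1 + M / h₁ 1 + M / -h₁ (-1)) + (1 + M / h₂ 1 + M / -h₂ (-1)) + (1 + 2 * M) + 1,
    by linarith, ?_⟩
  intro T _ x z v hx hz hv hinit t ht htT
  have hsub : Set.Icc 0 t ⊆ {s : ℝ | 0 ≤ s ∧ (s : WithTop ℝ) < T} := fun s hs =>
    ⟨hs.1, (WithTop.coe_le_coe.mpr hs.2).trans_lt htT⟩
  have hderiv : ∀ s ∈ Set.Icc 0 t, HasDerivWithinAt
      (fun s => (∫ r in (0:ℝ)..x s, h₁ r) + (∫ r in (0:ℝ)..z s, h₂ r) + v s ^ 2 / 2)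
      (h₂ (z s) * (f₁ (z s) * g₁ (v s) + f₂ (z s) * g₂ (v s)) - v s * c (x s) (z s) (v s))
      (Set.Icc 0 t) s := by
    intro s hs
    obtain ⟨hs0, hsT⟩ := hsub hs
    have d₁ := (hc₁.integral_hasStrictDerivAt 0 (x s)).hasDerivAt.comp_hasDerivWithinAt s
      ((hx s hs0 hsT).mono hsub)
    have d₂ := (hc₂.integral_hasStrictDerivAt 0 (z s)).hasDerivAt.comp_hasDerivWithinAt s
      ((hz s hs0 hsT).mono hsub)
    have d₃ := (((hv s hs0 hsT).mono hsub).pow 2).div_const 2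
    refine ((d₁.add d₂).add d₃).congr_deriv ?_
    push_cast
    ring
  have hanti := antitoneOn_of_hasDerivWithinAt_nonpos (convex_Icc 0 t)
    (fun s hs => (hderiv s hs).continuousWithinAt)
    (fun s hs => (hderiv s (interior_subset hs)).mono interior_subset)
    (fun s _ => by linarith [damping (z s) (v s), hcv (x s) (z s) (v s)])
  have henergy := hanti (Set.left_mem_Icc.mpr ht) (Set.right_mem_Icc.mpr ht) ht
  have hsq := (Real.sqrt_le_left hα.le).mp hinit
  have hx0 := integral_le_of_monotone hc₁ hh₁mono.monotone hh₁0
    (abs_le_of_sq_le_sq (by nlinarith [sq_nonneg (z 0), sq_nonneg (v 0)]) hα.le :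
      |x 0| ≤ α)
  have hz0 := integral_le_of_monotone hc₂ hh₂mono.monotone hh₂0
    (abs_le_of_sq_le_sq (by nlinarith [sq_nonneg (x 0), sq_nonneg (v 0)]) hα.le :
      |z 0| ≤ α)
  have hx1 := integral_nonneg_of_monotone hc₁ hh₁mono.monotone hh₁0 (x t)
  have hz1 := integral_nonneg_of_monotone hc₂ hh₂mono.monotone hh₂0 (z t)
  simp only at henergy
  have hMt : (∫ r in (0:ℝ)..x t, h₁ r) + (∫ r in (0:ℝ)..z t, h₂ r) + v t ^ 2 / 2 ≤ M := by
    linarith [sq_nonneg (x 0), sq_nonneg (z 0)]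
  have hv1 := sq_nonneg (v t)
  have hxt := abs_le_of_integral_le hc₁ hh₁mono hh₁0 (y := x t) (M := M) (by linarith)
  have hzt := abs_le_of_integral_le hc₂ hh₂mono hh₂0 (y := z t) (M := M) (by linarith)
  have hvt : |v t| ≤ 1 + 2 * M := abs_le_of_sq_le_sq (by nlinarith) (by linarith)
  have hnorm : Real.sqrt (x t ^ 2 + z t ^ 2 + v t ^ 2) ≤ |x t| + |z t| + |v t| := by
    refine Real.sqrt_le_iff.mpr ⟨by positivity, ?_⟩
    rw [← sq_abs (x t), ← sq_abs (z t), ← sq_abs (v t)]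
    nlinarith [mul_nonneg (abs_nonneg (x t)) (abs_nonneg (z t)),
      mul_nonneg (abs_nonneg (x t)) (abs_nonneg (v t)),
      mul_nonneg (abs_nonneg (z t)) (abs_nonneg (v t))]
  linarith
end

section
/- For every initial condition (x₀, z₀, v₀) ∈ ℝ³ there exists a unique global solution of the oscillator: a unique triple of differentiable functions x, z, v : [0, +∞) → ℝ with x(0) = x₀, z(0) = z₀, v(0) = v₀ and x'(t) = v(t), z'(t) = v(t) + f₁(z(t))g₁(v(t)) + f₂(z(t))g₂(v(t)), v'(t) = −h₁(x(t)) − h₂(z(t)) − c(x(t), z(t), v(t)) for all t ≥ 0. -/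
open Set Filter Topology Metric
open scoped NNReal

section ODE

variable {E : Type*} [NormedAddCommGroup E] [NormedSpace ℝ E]

/-- Pointwise products of locally Lipschitz scalar and vector functions are locally Lipschitz. -/
theorem LocallyLipschitz.smul_fun {X : Type*} [PseudoEMetricSpace X] {a : X → ℝ} {f : X → E}
    (ha : LocallyLipschitz a) (hf : LocallyLipschitz f) :
    LocallyLipschitz fun x => a x • f x :=
  (contDiff_smul (𝕜 := ℝ) (F := E) (n := 1)).locallyLipschitz.comp (ha.prodMk hf)

/-- Forward uniqueness for autonomous locally Lipschitz vector fields. -/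
theorem LocallyLipschitz.eqOn_of_isIntegralCurveOn_Icc [ProperSpace E] {F : E → E}
    (hF : LocallyLipschitz F) {T : ℝ} {α β : ℝ → E}
    (hα : IsIntegralCurveOn α (fun _ => F) (Icc 0 T))
    (hβ : IsIntegralCurveOn β (fun _ => F) (Icc 0 T)) (h0 : α 0 = β 0) :
    EqOn α β (Icc 0 T) := by
  have hK : IsCompact (α '' Icc 0 T ∪ β '' Icc 0 T) :=
    (isCompact_Icc.image_of_continuousOn hα.continuousOn).union
      (isCompact_Icc.image_of_continuousOn hβ.continuousOn)
  obtain ⟨K, hKlip⟩ := (hF.locallyLipschitzOn).exists_lipschitzOnWith_of_compact hK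
  have key : ∀ γ : ℝ → E, IsIntegralCurveOn γ (fun _ => F) (Icc 0 T) →
      ∀ t ∈ Ico 0 T, HasDerivWithinAt γ (F (γ t)) (Ici t) t := fun γ hγ t ht =>
    (hγ t (Ico_subset_Icc_self ht)).mono_of_mem_nhdsWithin
      (mem_of_superset (Icc_mem_nhdsGE ht.2) (Icc_subset_Icc_left ht.1))
  exact ODE_solution_unique_of_mem_Icc_right (v := fun _ => F) (s := fun _ => _)
    (fun _ _ => hKlip) hα.continuousOn (key α hα)
    (fun t ht => Or.inl (mem_image_of_mem _ (Ico_subset_Icc_self ht)))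
    hβ.continuousOn (key β hβ)
    (fun t ht => Or.inr (mem_image_of_mem _ (Ico_subset_Icc_self ht))) h0

/-- A bounded locally Lipschitz vector field has integral curves on `[0, T]`. -/
theorem LocallyLipschitz.exists_isIntegralCurveOn_Icc_of_bounded [ProperSpace E] {F : E → E}
    (hF : LocallyLipschitz F) {C : ℝ} (hC : ∀ x, ‖F x‖ ≤ C) (x₀ : E) {T : ℝ} (hT : 0 ≤ T) :
    ∃ α : ℝ → E, α 0 = x₀ ∧ IsIntegralCurveOn α (fun _ => F) (Icc 0 T) := by
  obtain ⟨K, hK⟩ := (hF.locallyLipschitzOn).exists_lipschitzOnWith_of_compact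
    (isCompact_closedBall x₀ ((C.toNNReal * T.toNNReal : ℝ≥0) : ℝ))
  have hP : IsPicardLindelof (fun _ => F) (⟨0, left_mem_Icc.2 hT⟩ : Icc (0 : ℝ) T) x₀
      (C.toNNReal * T.toNNReal) 0 C.toNNReal K :=
    { lipschitzOnWith := fun _ _ => hK
      continuousOn := fun _ _ => continuousOn_const
      norm_le := fun _ _ x _ => (hC x).trans (Real.le_coe_toNNReal C)
      mul_max_le := by simp [hT] }
  exact hP.exists_eq_forall_mem_Icc_hasDerivWithinAt₀

/-- A bounded locally Lipschitz vector field has integral curves on `[0, ∞)`. -/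
theorem LocallyLipschitz.exists_isIntegralCurveOn_Ici_of_bounded [ProperSpace E] {F : E → E}
    (hF : LocallyLipschitz F) {C : ℝ} (hC : ∀ x, ‖F x‖ ≤ C) (x₀ : E) :
    ∃ α : ℝ → E, α 0 = x₀ ∧ IsIntegralCurveOn α (fun _ => F) (Ici 0) := by
  choose α hα0 hα using fun n : ℕ =>
    hF.exists_isIntegralCurveOn_Icc_of_bounded hC x₀ (Nat.cast_nonneg (α := ℝ) n)
  have hagree : ∀ m n : ℕ, m ≤ n → EqOn (α m) (α n) (Icc 0 m) := fun m n hmn =>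
    hF.eqOn_of_isIntegralCurveOn_Icc (hα m)
      ((hα n).mono (Icc_subset_Icc_right (Nat.cast_le.2 hmn))) ((hα0 m).trans (hα0 n).symm)
  have hglue : ∀ n : ℕ, EqOn (fun t => α ⌈t⌉₊ t) (α n) (Icc 0 n) := fun n t ht =>
    hagree _ _ (Nat.ceil_le.2 ht.2) ⟨ht.1, Nat.le_ceil t⟩
  refine ⟨fun t => α ⌈t⌉₊ t, by simp [hα0], fun t ht => ?_⟩
  obtain ⟨n, hn⟩ := exists_nat_gt t
  have htn : t ∈ Icc (0 : ℝ) n := ⟨ht, hn.le⟩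
  have hd := (hα n t htn).congr (hglue n) (hglue n htn)
  rw [← hglue n htn] at hd
  refine hd.mono_of_mem_nhdsWithin ?_
  rw [← Ici_inter_Iic]
  exact inter_mem_nhdsWithin _ (Iic_mem_nhds hn)

/-- A locally Lipschitz vector field with a Lyapunov function all of whose sublevel sets are
bounded has integral curves on `[0, ∞)`. -/
theorem LocallyLipschitz.exists_isIntegralCurveOn_Ici_of_lyapunov [FiniteDimensional ℝ E]
    {F : E → E} (hF : LocallyLipschitz F) {W : E → ℝ} {W' : E → E →L[ℝ] ℝ}
    (hW : ∀ p, HasFDerivAt W (W' p) p) (hdec : ∀ p, W' p (F p) ≤ 0)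
    (hbdd : ∀ r, Bornology.IsBounded {p | W p ≤ r}) (x₀ : E) :
    ∃ α : ℝ → E, α 0 = x₀ ∧ IsIntegralCurveOn α (fun _ => F) (Ici 0) := by
  have : ProperSpace E := FiniteDimensional.proper ℝ E
  obtain ⟨R, hR0, hR⟩ := (hbdd (W x₀)).subset_closedBall_lt 0 0
  let χ : ContDiffBump (0 : E) := ⟨R, R + 1, hR0, lt_add_one R⟩
  have hG : LocallyLipschitz fun p => χ p • F p :=
    (χ.contDiff (n := 1)).locallyLipschitz.smul_fun hF
  obtain ⟨C, hC⟩ := hG.continuous.bounded_above_of_compact_support χ.hasCompactSupport.smul_right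
  obtain ⟨α, hα0, hα⟩ := hG.exists_isIntegralCurveOn_Ici_of_bounded hC x₀
  have hWα : ∀ t ∈ Ici (0 : ℝ),
      HasDerivWithinAt (W ∘ α) (W' (α t) (χ (α t) • F (α t))) (Ici 0) t :=
    fun t ht => (hW (α t)).comp_hasDerivWithinAt t (hα t ht)
  have hanti : AntitoneOn (W ∘ α) (Ici 0) := by
    refine antitoneOn_of_hasDerivWithinAt_nonpos (convex_Ici 0)
      (fun t ht => (hWα t ht).continuousWithinAt)
      (fun t ht => (hWα t (interior_subset ht)).mono interior_subset) fun t _ => ?_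
    rw [map_smul, smul_eq_mul]
    exact mul_nonpos_of_nonneg_of_nonpos χ.nonneg (hdec _)
  refine ⟨α, hα0, fun t ht => ?_⟩
  have hle : W (α t) ≤ W x₀ := hα0 ▸ hanti (mem_Ici.2 le_rfl) ht ht
  have h1 : χ (α t) = 1 := χ.one_of_mem_closedBall (hR hle)
  simpa only [h1, one_smul] using hα t ht

end ODE

/-- The primitive of a monotone function lies above its tangent lines. -/
theorem Monotone.mul_sub_le_integral {h : ℝ → ℝ} (hm : Monotone h) (a y : ℝ) :
    h a * (y - a) ≤ ∫ s in a..y, h s := by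
  have hint : ∀ u w, IntervalIntegrable h MeasureTheory.volume u w :=
    fun _ _ => hm.intervalIntegrable
  rcases le_total a y with hay | hya
  · have := intervalIntegral.integral_mono_on hay intervalIntegrable_const (hint a y)
      fun s hs => hm hs.1
    simpa [mul_comm] using this
  · have := intervalIntegral.integral_mono_on hya (hint y a) intervalIntegrable_const
      fun s hs => hm hs.2
    rw [intervalIntegral.integral_symm]
    simp only [intervalIntegral.integral_const, smul_eq_mul] at this
    linarith

/-- The primitive of a monotone function vanishing at `0` is nonnegative. -/
theorem Monotone.integral_nonneg_of_zero {h : ℝ → ℝ} (hm : Monotone h) (h0 : h 0 = 0) (y : ℝ) :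
    0 ≤ ∫ s in (0 : ℝ)..y, h s := by
  simpa [h0] using hm.mul_sub_le_integral 0 y

/-- The primitive of a strictly increasing function vanishing at `0` is coercive. -/
theorem StrictMono.exists_abs_le_of_integral_le {h : ℝ → ℝ} (hm : StrictMono h) (h0 : h 0 = 0)
    (r : ℝ) : ∃ M, ∀ y, ∫ s in (0 : ℝ)..y, h s ≤ r → |y| ≤ M := by
  have hp : 0 < h 1 := h0 ▸ hm one_pos
  have hn : h (-1) < 0 := h0 ▸ hm (by norm_num : (-1 : ℝ) < 0)
  have hint : ∀ u w, IntervalIntegrable h MeasureTheory.volume u w :=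
    fun _ _ => hm.monotone.intervalIntegrable
  have tangent : ∀ a y, h a * (y - a) ≤ ∫ s in (0 : ℝ)..y, h s := fun a y => by
    rw [← intervalIntegral.integral_add_adjacent_intervals (hint 0 a) (hint a y)]
    linarith [hm.monotone.integral_nonneg_of_zero h0 a, hm.monotone.mul_sub_le_integral a y]
  refine ⟨max (1 + r / h 1) (1 + r / (-h (-1))), fun y hy => abs_le'.2 ⟨?_, ?_⟩⟩
  · refine le_trans ?_ (le_max_left _ _)
    rw [← sub_le_iff_le_add', le_div_iff₀ hp]
    linarith [tangent 1 y]
  · refine le_trans ?_ (le_max_right _ _)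
    rw [← sub_le_iff_le_add', le_div_iff₀ (neg_pos.2 hn)]
    linarith [tangent (-1) y]


/-- Global existence and uniqueness of solutions of the oscillator for every
initial condition. -/
theorem exists_unique_global_solution
    (f₁ f₂ g₁ g₂ h₁ h₂ : ℝ → ℝ) (c : ℝ → ℝ → ℝ → ℝ)
    (hf₁lip : LocallyLipschitz f₁) (hf₂lip : LocallyLipschitz f₂)
    (hg₁lip : LocallyLipschitz g₁) (hg₂lip : LocallyLipschitz g₂)
    (hh₁lip : LocallyLipschitz h₁) (hh₂lip : LocallyLipschitz h₂)
    (hh₁mono : StrictMono h₁) (hh₂mono : StrictMono h₂)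
    (hf₁0 : f₁ 0 = 0) (hf₂0 : f₂ 0 = 0) (hg₁0 : g₁ 0 = 0) (hg₂0 : g₂ 0 = 0)
    (hh₁0 : h₁ 0 = 0) (hh₂0 : h₂ 0 = 0)
    (hfneg : ∀ z < (0:ℝ), 0 < f₁ z ∧ f₂ z < 0)
    (hfpos : ∀ z > (0:ℝ), f₁ z < 0 ∧ 0 < f₂ z)
    (hgpos : ∀ v > (0:ℝ), 0 < g₁ v ∧ g₂ v = 0)
    (hgneg : ∀ v < (0:ℝ), g₁ v = 0 ∧ g₂ v < 0)
    (hclip : LocallyLipschitz (fun p : ℝ × ℝ × ℝ => c p.1 p.2.1 p.2.2))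
    (hc0 : ∀ x z : ℝ, c x z 0 = 0)
    (hcv : ∀ x z v : ℝ, 0 ≤ v * c x z v)
    (x₀ z₀ v₀ : ℝ) :
    ∃ x z v : ℝ → ℝ,
      (x 0 = x₀ ∧ z 0 = z₀ ∧ v 0 = v₀ ∧
       (∀ t ∈ Set.Ici (0:ℝ), HasDerivWithinAt x (v t) (Set.Ici 0) t) ∧
       (∀ t ∈ Set.Ici (0:ℝ), HasDerivWithinAt z
         (v t + f₁ (z t) * g₁ (v t) + f₂ (z t) * g₂ (v t)) (Set.Ici 0) t) ∧
       (∀ t ∈ Set.Ici (0:ℝ), HasDerivWithinAt v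
         (-h₁ (x t) - h₂ (z t) - c (x t) (z t) (v t)) (Set.Ici 0) t)) ∧
      (∀ x' z' v' : ℝ → ℝ,
        (x' 0 = x₀ ∧ z' 0 = z₀ ∧ v' 0 = v₀ ∧
         (∀ t ∈ Set.Ici (0:ℝ), HasDerivWithinAt x' (v' t) (Set.Ici 0) t) ∧
         (∀ t ∈ Set.Ici (0:ℝ), HasDerivWithinAt z'
           (v' t + f₁ (z' t) * g₁ (v' t) + f₂ (z' t) * g₂ (v' t)) (Set.Ici 0) t) ∧
         (∀ t ∈ Set.Ici (0:ℝ), HasDerivWithinAt v'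
           (-h₁ (x' t) - h₂ (z' t) - c (x' t) (z' t) (v' t)) (Set.Ici 0) t)) →
        ∀ t ∈ Set.Ici (0:ℝ), x' t = x t ∧ z' t = z t ∧ v' t = v t) := by
  let F : ℝ × ℝ × ℝ → ℝ × ℝ × ℝ := fun p =>
    (p.2.2, p.2.2 + f₁ p.2.1 * g₁ p.2.2 + f₂ p.2.1 * g₂ p.2.2,
      -h₁ p.1 - h₂ p.2.1 - c p.1 p.2.1 p.2.2)
  have hx : LocallyLipschitz fun p : ℝ × ℝ × ℝ => p.1 := LipschitzWith.prod_fst.locallyLipschitz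
  have hz : LocallyLipschitz fun p : ℝ × ℝ × ℝ => p.2.1 :=
    (LipschitzWith.prod_fst.comp LipschitzWith.prod_snd).locallyLipschitz
  have hv : LocallyLipschitz fun p : ℝ × ℝ × ℝ => p.2.2 :=
    (LipschitzWith.prod_snd.comp LipschitzWith.prod_snd).locallyLipschitz
  have hF : LocallyLipschitz F :=
    hv.prodMk (((hv.add ((hf₁lip.comp hz).smul_fun (hg₁lip.comp hv))).add
      ((hf₂lip.comp hz).smul_fun (hg₂lip.comp hv))).prodMk
        (((hh₁lip.comp hx).neg.sub (hh₂lip.comp hz)).sub hclip))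
  have hprim : ∀ h : ℝ → ℝ, Continuous h → ∀ y,
      HasDerivAt (fun y => ∫ s in (0 : ℝ)..y, h s) (h y) y :=
    fun h hc y => hc.integral_hasStrictDerivAt 0 y |>.hasDerivAt
  let W : ℝ × ℝ × ℝ → ℝ := fun p =>
    (∫ s in (0 : ℝ)..p.1, h₁ s) + (∫ s in (0 : ℝ)..p.2.1, h₂ s) + p.2.2 ^ 2 / 2
  let π₁ := ContinuousLinearMap.fst ℝ ℝ (ℝ × ℝ)
  let π₂ := (ContinuousLinearMap.fst ℝ ℝ ℝ).comp (ContinuousLinearMap.snd ℝ ℝ (ℝ × ℝ))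
  let π₃ := (ContinuousLinearMap.snd ℝ ℝ ℝ).comp (ContinuousLinearMap.snd ℝ ℝ (ℝ × ℝ))
  have hW : ∀ p : ℝ × ℝ × ℝ, HasFDerivAt W (h₁ p.1 • π₁ + h₂ p.2.1 • π₂ + p.2.2 • π₃) p := by
    intro p
    have hsq : HasDerivAt (fun y : ℝ => y ^ 2 / 2) (p.2.2) p.2.2 := by
      simpa using (hasDerivAt_pow 2 p.2.2).div_const 2
    exact (((hprim h₁ hh₁lip.continuous p.1).comp_hasFDerivAt p π₁.hasFDerivAt).add
      ((hprim h₂ hh₂lip.continuous p.2.1).comp_hasFDerivAt p π₂.hasFDerivAt)).add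
        (hsq.comp_hasFDerivAt p π₃.hasFDerivAt)
  have hdissip : ∀ z v, h₂ z * (f₁ z * g₁ v) ≤ 0 ∧ h₂ z * (f₂ z * g₂ v) ≤ 0 := by
    intro z v
    have hgv : 0 ≤ g₁ v ∧ g₂ v ≤ 0 := by
      rcases lt_trichotomy v 0 with h | rfl | h
      · exact ⟨(hgneg v h).1.ge, (hgneg v h).2.le⟩
      · exact ⟨hg₁0.ge, hg₂0.le⟩
      · exact ⟨(hgpos v h).1.le, (hgpos v h).2.le⟩
    have hfz : h₂ z * f₁ z ≤ 0 ∧ 0 ≤ h₂ z * f₂ z := by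
      rcases lt_trichotomy z 0 with h | rfl | h
      · have hh : h₂ z < 0 := hh₂0 ▸ hh₂mono h
        exact ⟨(mul_neg_of_neg_of_pos hh (hfneg z h).1).le,
          (mul_pos_of_neg_of_neg hh (hfneg z h).2).le⟩
      · simp [hh₂0]
      · have hh : 0 < h₂ z := hh₂0 ▸ hh₂mono h
        exact ⟨(mul_neg_of_pos_of_neg hh (hfpos z h).1).le, (mul_pos hh (hfpos z h).2).le⟩
    rw [← mul_assoc, ← mul_assoc]
    exact ⟨mul_nonpos_of_nonpos_of_nonneg hfz.1 hgv.1,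
      mul_nonpos_of_nonneg_of_nonpos hfz.2 hgv.2⟩
  have hdec : ∀ p, (h₁ p.1 • π₁ + h₂ p.2.1 • π₂ + p.2.2 • π₃) (F p) ≤ 0 := by
    rintro ⟨x, z, v⟩
    have hval : (h₁ x • π₁ + h₂ z • π₂ + v • π₃) (F (x, z, v)) =
        h₁ x * v + h₂ z * (v + f₁ z * g₁ v + f₂ z * g₂ v) + v * (-h₁ x - h₂ z - c x z v) := rfl
    change (h₁ x • π₁ + h₂ z • π₂ + v • π₃) (F (x, z, v)) ≤ 0
    rw [hval]
    linarith [hcv x z v, (hdissip z v).1, (hdissip z v).2]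
  have hbdd : ∀ r, Bornology.IsBounded {p | W p ≤ r} := by
    intro r
    obtain ⟨M₁, hM₁⟩ := hh₁mono.exists_abs_le_of_integral_le hh₁0 r
    obtain ⟨M₂, hM₂⟩ := hh₂mono.exists_abs_le_of_integral_le hh₂0 r
    refine ((isBounded_Icc (-M₁) M₁).prod ((isBounded_Icc (-M₂) M₂).prod
      (isBounded_Icc (-(2 * r + 1)) (2 * r + 1)))).subset ?_
    rintro ⟨x, z, v⟩ hp
    have hp' : (∫ s in (0 : ℝ)..x, h₁ s) + (∫ s in (0 : ℝ)..z, h₂ s) + v ^ 2 / 2 ≤ r := hp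
    have n₁ := hh₁mono.monotone.integral_nonneg_of_zero hh₁0 x
    have n₂ := hh₂mono.monotone.integral_nonneg_of_zero hh₂0 z
    have n₃ := sq_nonneg v
    refine ⟨abs_le.1 (hM₁ x (by linarith)), abs_le.1 (hM₂ z (by linarith)), ?_, ?_⟩
    · change -(2 * r + 1) ≤ v
      nlinarith [sq_nonneg (v + 1)]
    · change v ≤ 2 * r + 1
      nlinarith [sq_nonneg (v - 1)]
  obtain ⟨α, hα0, hα⟩ := hF.exists_isIntegralCurveOn_Ici_of_lyapunov hW hdec hbdd (x₀, z₀, v₀)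
  refine ⟨fun t => (α t).1, fun t => (α t).2.1, fun t => (α t).2.2,
    ⟨by simp [hα0], by simp [hα0], by simp [hα0],
      fun t ht => π₁.hasFDerivAt.comp_hasDerivWithinAt t (hα t ht),
      fun t ht => π₂.hasFDerivAt.comp_hasDerivWithinAt t (hα t ht),
      fun t ht => π₃.hasFDerivAt.comp_hasDerivWithinAt t (hα t ht)⟩, ?_⟩
  rintro x z v ⟨hx0, hz0, hv0, hx', hz', hv'⟩ t ht
  have hβ : IsIntegralCurveOn (fun t => (x t, z t, v t)) (fun _ => F) (Ici 0) :=
    fun t ht => (hx' t ht).prodMk ((hz' t ht).prodMk (hv' t ht))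
  have heq := hF.eqOn_of_isIntegralCurveOn_Icc (T := t) (hβ.mono Icc_subset_Ici_self)
    (hα.mono Icc_subset_Ici_self) (by simp [hα0, hx0, hz0, hv0]) (right_mem_Icc.2 ht)
  exact ⟨congrArg Prod.fst heq, congrArg (fun p => p.2.1) heq, congrArg (fun p => p.2.2) heq⟩
end

section
/- The origin 0 ∈ ℝ³ is a Lyapunov stable equilibrium point of the oscillator: for every ε > 0 there exists δ > 0 such that every global solution X = (x, z, v) : [0, +∞) → ℝ³ of the oscillator with ‖X(0)‖₂ < δ satisfies ‖X(t)‖₂ < ε for all t ≥ 0. -/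
/-- A strictly increasing continuous function vanishing at `0` has a primitive which is nonnegative,
vanishes at `0`, and whose small sublevel sets are small. -/
theorem exists_potential_of_strictMono {h : ℝ → ℝ} (hcont : Continuous h) (hmono : StrictMono h)
    (h0 : h 0 = 0) :
    ∃ H : ℝ → ℝ, (∀ x, HasDerivAt H (h x) x) ∧ H 0 = 0 ∧ (∀ x, 0 ≤ H x) ∧
      ∀ r > 0, ∃ m > 0, ∀ x, H x < m → |x| < r := by
  obtain ⟨H, hH, hH0⟩ : ∃ H : ℝ → ℝ, (∀ x, HasDerivAt H (h x) x) ∧ H 0 = 0 :=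
    ⟨fun x => ∫ s in (0 : ℝ)..x, h s,
      fun x => intervalIntegral.integral_hasDerivAt_right (hcont.intervalIntegrable _ _)
        hcont.aestronglyMeasurable.stronglyMeasurableAtFilter hcont.continuousAt,
      intervalIntegral.integral_same⟩
  have hHcont : Continuous H := continuous_iff_continuousAt.2 fun x => (hH x).continuousAt
  have hup : StrictMonoOn H (Set.Ici 0) := by
    refine strictMonoOn_of_deriv_pos (convex_Ici 0) hHcont.continuousOn fun x hx => ?_
    rw [interior_Ici, Set.mem_Ioi] at hx
    rw [(hH x).deriv, ← h0]
    exact hmono hx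
  have hdown : StrictAntiOn H (Set.Iic 0) := by
    refine strictAntiOn_of_deriv_neg (convex_Iic 0) hHcont.continuousOn fun x hx => ?_
    rw [interior_Iic, Set.mem_Iio] at hx
    rw [(hH x).deriv, ← h0]
    exact hmono hx
  refine ⟨H, hH, hH0, fun x => ?_, fun r hr => ⟨min (H r) (H (-r)), ?_, fun x hx => ?_⟩⟩
  · rw [← hH0]
    rcases le_total 0 x with hx | hx
    · exact hup.monotoneOn Set.self_mem_Ici hx hx
    · exact hdown.antitoneOn hx Set.self_mem_Iic hx
  · have hneg : -r < 0 := neg_lt_zero.2 hr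
    rw [gt_iff_lt, lt_min_iff, ← hH0]
    exact ⟨hup Set.self_mem_Ici hr.le hr, hdown hneg.le Set.self_mem_Iic hneg⟩
  · rw [lt_min_iff] at hx
    refine abs_lt.2 ⟨?_, ?_⟩ <;> by_contra! hxr
    · have hx0 : x ≤ 0 := by linarith
      exact absurd (hdown.antitoneOn hx0 (neg_nonpos.2 hr.le) hxr) hx.2.not_ge
    · exact absurd (hup.monotoneOn hr.le (hr.le.trans hxr) hxr) hx.1.not_ge

/-- The power dissipated by the hysteretic element is nonpositive. -/
theorem hysteresis_power_nonpos {f₁ f₂ g₁ g₂ h₂ : ℝ → ℝ} (hh₂mono : StrictMono h₂)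
    (hg₁0 : g₁ 0 = 0) (hg₂0 : g₂ 0 = 0) (hh₂0 : h₂ 0 = 0)
    (hfneg : ∀ z < (0:ℝ), 0 < f₁ z ∧ f₂ z < 0)
    (hfpos : ∀ z > (0:ℝ), f₁ z < 0 ∧ 0 < f₂ z)
    (hgpos : ∀ v > (0:ℝ), 0 < g₁ v ∧ g₂ v = 0)
    (hgneg : ∀ v < (0:ℝ), g₁ v = 0 ∧ g₂ v < 0) (z v : ℝ) :
    h₂ z * (f₁ z * g₁ v + f₂ z * g₂ v) ≤ 0 := by
  have hg : 0 ≤ g₁ v ∧ g₂ v ≤ 0 := by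
    rcases lt_trichotomy v 0 with hv | rfl | hv
    · exact ⟨(hgneg v hv).1.ge, (hgneg v hv).2.le⟩
    · exact ⟨hg₁0.ge, hg₂0.le⟩
    · exact ⟨(hgpos v hv).1.le, (hgpos v hv).2.le⟩
  rcases lt_trichotomy z 0 with hz | rfl | hz
  · have hh : h₂ z < 0 := hh₂0 ▸ hh₂mono hz
    exact mul_nonpos_of_nonpos_of_nonneg hh.le <| add_nonneg
      (mul_nonneg (hfneg z hz).1.le hg.1) (mul_nonneg_of_nonpos_of_nonpos (hfneg z hz).2.le hg.2)
  · simp [hh₂0]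
  · have hh : 0 < h₂ z := hh₂0 ▸ hh₂mono hz
    exact mul_nonpos_of_nonneg_of_nonpos hh.le <| add_nonpos
      (mul_nonpos_of_nonpos_of_nonneg (hfpos z hz).1.le hg.1)
      (mul_nonpos_of_nonneg_of_nonpos (hfpos z hz).2.le hg.2)

/-- The origin is a Lyapunov stable equilibrium point of the oscillator. -/
theorem origin_lyapunov_stable
    (f₁ f₂ g₁ g₂ h₁ h₂ : ℝ → ℝ) (c : ℝ → ℝ → ℝ → ℝ)
    (hf₁lip : LocallyLipschitz f₁) (hf₂lip : LocallyLipschitz f₂)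
    (hg₁lip : LocallyLipschitz g₁) (hg₂lip : LocallyLipschitz g₂)
    (hh₁lip : LocallyLipschitz h₁) (hh₂lip : LocallyLipschitz h₂)
    (hh₁mono : StrictMono h₁) (hh₂mono : StrictMono h₂)
    (hf₁0 : f₁ 0 = 0) (hf₂0 : f₂ 0 = 0) (hg₁0 : g₁ 0 = 0) (hg₂0 : g₂ 0 = 0)
    (hh₁0 : h₁ 0 = 0) (hh₂0 : h₂ 0 = 0)
    (hfneg : ∀ z < (0:ℝ), 0 < f₁ z ∧ f₂ z < 0)
    (hfpos : ∀ z > (0:ℝ), f₁ z < 0 ∧ 0 < f₂ z)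
    (hgpos : ∀ v > (0:ℝ), 0 < g₁ v ∧ g₂ v = 0)
    (hgneg : ∀ v < (0:ℝ), g₁ v = 0 ∧ g₂ v < 0)
    (hclip : LocallyLipschitz (fun p : ℝ × ℝ × ℝ => c p.1 p.2.1 p.2.2))
    (hc0 : ∀ x z : ℝ, c x z 0 = 0)
    (hcv : ∀ x z v : ℝ, 0 ≤ v * c x z v)
    :
    ∀ ε > (0:ℝ), ∃ δ > (0:ℝ),
      ∀ x z v : ℝ → ℝ,
      (∀ t ∈ Set.Ici (0:ℝ), HasDerivWithinAt x (v t) (Set.Ici 0) t) →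
      (∀ t ∈ Set.Ici (0:ℝ), HasDerivWithinAt z
        (v t + f₁ (z t) * g₁ (v t) + f₂ (z t) * g₂ (v t)) (Set.Ici 0) t) →
      (∀ t ∈ Set.Ici (0:ℝ), HasDerivWithinAt v
        (-h₁ (x t) - h₂ (z t) - c (x t) (z t) (v t)) (Set.Ici 0) t) →
      Real.sqrt ((x 0) ^ 2 + (z 0) ^ 2 + (v 0) ^ 2) < δ →
      ∀ t : ℝ, 0 ≤ t →
        Real.sqrt ((x t) ^ 2 + (z t) ^ 2 + (v t) ^ 2) < ε := by
  intro ε hε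
  obtain ⟨H₁, hH₁, hH₁0, hH₁nn, hH₁small⟩ :=
    exists_potential_of_strictMono hh₁lip.continuous hh₁mono hh₁0
  obtain ⟨H₂, hH₂, hH₂0, hH₂nn, hH₂small⟩ :=
    exists_potential_of_strictMono hh₂lip.continuous hh₂mono hh₂0
  have hr : 0 < ε / 2 := half_pos hε
  obtain ⟨m₁, hm₁, hx_small⟩ := hH₁small _ hr
  obtain ⟨m₂, hm₂, hz_small⟩ := hH₂small _ hr
  obtain ⟨m, hm, hmm₁, hmm₂, hmv⟩ : ∃ m > 0, m ≤ m₁ ∧ m ≤ m₂ ∧ m ≤ (ε / 2) ^ 2 / 2 :=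
    ⟨min m₁ (min m₂ ((ε / 2) ^ 2 / 2)), by positivity, by simp, by simp, by simp⟩
  have hcont : Continuous fun p : ℝ × ℝ × ℝ => H₁ p.1 + H₂ p.2.1 + p.2.2 ^ 2 / 2 := by
    have hc₁ : Continuous H₁ := continuous_iff_continuousAt.2 fun x => (hH₁ x).continuousAt
    have hc₂ : Continuous H₂ := continuous_iff_continuousAt.2 fun x => (hH₂ x).continuousAt
    fun_prop
  obtain ⟨δ, hδ, hball⟩ := Metric.continuousAt_iff.1 (hcont.continuousAt (x := 0)) m hm
  refine ⟨δ, hδ, fun x z v hx hz hv hinit t ht => ?_⟩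
  have hderiv : ∀ s ∈ Set.Ici (0 : ℝ),
      HasDerivWithinAt (fun s => H₁ (x s) + H₂ (z s) + v s ^ 2 / 2)
        (h₂ (z s) * (f₁ (z s) * g₁ (v s) + f₂ (z s) * g₂ (v s)) - v s * c (x s) (z s) (v s))
        (Set.Ici 0) s := fun s hs => by
    refine ((((hH₁ (x s)).comp_hasDerivWithinAt s (hx s hs)).add
      ((hH₂ (z s)).comp_hasDerivWithinAt s (hz s hs))).add
      (((hv s hs).pow 2).div_const 2)).congr_deriv ?_
    push_cast
    ring
  have hanti : AntitoneOn (fun s => H₁ (x s) + H₂ (z s) + v s ^ 2 / 2) (Set.Ici 0) :=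
    antitoneOn_of_hasDerivWithinAt_nonpos (convex_Ici 0)
      (fun s hs => (hderiv s hs).continuousWithinAt)
      (fun s hs => (hderiv s (interior_subset hs)).mono interior_subset)
      (fun s _ => sub_nonpos.2 <| (hysteresis_power_nonpos hh₂mono hg₁0 hg₂0 hh₂0 hfneg hfpos
        hgpos hgneg _ _).trans (hcv _ _ _))
  have hstart : H₁ (x 0) + H₂ (z 0) + v 0 ^ 2 / 2 < m := by
    rw [Real.sqrt_lt' hδ] at hinit
    have hclose : dist (x 0, z 0, v 0) (0 : ℝ × ℝ × ℝ) < δ := by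
      simp only [dist_zero_right, Prod.norm_mk, Real.norm_eq_abs, max_lt_iff]
      refine ⟨?_, ?_, ?_⟩ <;> refine abs_lt_of_sq_lt_sq ?_ hδ.le <;>
        nlinarith [sq_nonneg (x 0), sq_nonneg (z 0), sq_nonneg (v 0)]
    have hdist := hball hclose
    simp only [Prod.fst_zero, Prod.snd_zero, hH₁0, hH₂0, Real.dist_eq] at hdist
    have := (abs_lt.1 hdist).2
    linarith
  have henergy : H₁ (x t) + H₂ (z t) + v t ^ 2 / 2 < m :=
    (hanti Set.self_mem_Ici ht ht).trans_lt hstart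
  have h₁nn := hH₁nn (x t)
  have h₂nn := hH₂nn (z t)
  have hvnn := sq_nonneg (v t)
  have hxt : x t ^ 2 < (ε / 2) ^ 2 :=
    sq_lt_sq' (abs_lt.1 (hx_small (x t) (by linarith))).1 (abs_lt.1 (hx_small (x t) (by linarith))).2
  have hzt : z t ^ 2 < (ε / 2) ^ 2 :=
    sq_lt_sq' (abs_lt.1 (hz_small (z t) (by linarith))).1 (abs_lt.1 (hz_small (z t) (by linarith))).2
  rw [Real.sqrt_lt' hε]
  nlinarith
end

section
/- The following chain of inclusions holds: E ⊆ M_v ⊆ V̇⁻¹(0) ⊆ M_z ∪ M_v, where E = {(x, z, v) ∈ ℝ³ : h₁(x) = −h₂(z) and v = 0}, M_z = {(x, z, v) ∈ ℝ³ : z = 0}, M_v = {(x, z, v) ∈ ℝ³ : v = 0}, and V̇⁻¹(0) = {(x, z, v) ∈ ℝ³ : V̇(x, z, v) = 0}. -/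
/-- The chain of inclusions `E ⊆ M_v ⊆ V̇⁻¹(0) ⊆ M_z ∪ M_v`. -/
theorem E_subset_Mv_subset_Vdot_zero_subset_Mz_union_Mv
    (f₁ f₂ g₁ g₂ h₁ h₂ : ℝ → ℝ) (c : ℝ → ℝ → ℝ → ℝ)
    (hf₁lip : LocallyLipschitz f₁) (hf₂lip : LocallyLipschitz f₂)
    (hg₁lip : LocallyLipschitz g₁) (hg₂lip : LocallyLipschitz g₂)
    (hh₁lip : LocallyLipschitz h₁) (hh₂lip : LocallyLipschitz h₂)
    (hh₁mono : StrictMono h₁) (hh₂mono : StrictMono h₂)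
    (hf₁0 : f₁ 0 = 0) (hf₂0 : f₂ 0 = 0) (hg₁0 : g₁ 0 = 0) (hg₂0 : g₂ 0 = 0)
    (hh₁0 : h₁ 0 = 0) (hh₂0 : h₂ 0 = 0)
    (hfneg : ∀ z < (0:ℝ), 0 < f₁ z ∧ f₂ z < 0)
    (hfpos : ∀ z > (0:ℝ), f₁ z < 0 ∧ 0 < f₂ z)
    (hgpos : ∀ v > (0:ℝ), 0 < g₁ v ∧ g₂ v = 0)
    (hgneg : ∀ v < (0:ℝ), g₁ v = 0 ∧ g₂ v < 0)
    (hclip : LocallyLipschitz (fun p : ℝ × ℝ × ℝ => c p.1 p.2.1 p.2.2))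
    (hc0 : ∀ x z : ℝ, c x z 0 = 0)
    (hcv : ∀ x z v : ℝ, 0 ≤ v * c x z v)
    :
    ({p : ℝ × ℝ × ℝ | h₁ p.1 = -h₂ p.2.1 ∧ p.2.2 = 0} ⊆
      {p : ℝ × ℝ × ℝ | p.2.2 = 0}) ∧
    ({p : ℝ × ℝ × ℝ | p.2.2 = 0} ⊆
      {p : ℝ × ℝ × ℝ | h₂ p.2.1 * f₁ p.2.1 * g₁ p.2.2 +
        h₂ p.2.1 * f₂ p.2.1 * g₂ p.2.2 - p.2.2 * c p.1 p.2.1 p.2.2 = 0}) ∧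
    ({p : ℝ × ℝ × ℝ | h₂ p.2.1 * f₁ p.2.1 * g₁ p.2.2 +
        h₂ p.2.1 * f₂ p.2.1 * g₂ p.2.2 - p.2.2 * c p.1 p.2.1 p.2.2 = 0} ⊆
      {p : ℝ × ℝ × ℝ | p.2.1 = 0} ∪ {p : ℝ × ℝ × ℝ | p.2.2 = 0}) := by
  refine ⟨fun p hp => hp.2, ?_, ?_⟩
  · rintro ⟨x, z, v⟩ hv
    obtain rfl : v = 0 := hv
    simp [hg₁0, hg₂0]
  · rintro ⟨x, z, v⟩ hV
    simp only [Set.mem_ofPred_eq, Set.mem_union] at hV ⊢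
    by_contra! hzv
    obtain ⟨hz, hv⟩ := hzv
    have hhf : h₂ z * f₁ z < 0 ∧ 0 < h₂ z * f₂ z := by
      rcases lt_or_gt_of_ne hz with hz | hz
      · have hh : h₂ z < 0 := hh₂0 ▸ hh₂mono hz
        exact ⟨mul_neg_of_neg_of_pos hh (hfneg z hz).1, mul_pos_of_neg_of_neg hh (hfneg z hz).2⟩
      · have hh : 0 < h₂ z := hh₂0 ▸ hh₂mono hz
        exact ⟨mul_neg_of_pos_of_neg hh (hfpos z hz).1, mul_pos hh (hfpos z hz).2⟩
    have hc := hcv x z v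
    rcases lt_or_gt_of_ne hv with hv | hv
    · obtain ⟨hg₁, hg₂⟩ := hgneg v hv
      have hneg := mul_neg_of_pos_of_neg hhf.2 hg₂
      rw [hg₁] at hV
      linarith
    · obtain ⟨hg₁, hg₂⟩ := hgpos v hv
      have hneg := mul_neg_of_neg_of_pos hhf.1 hg₁
      rw [hg₂] at hV
      linarith
end

section
/- If X = (x, z, v) : [0, +∞) → ℝ³ is a global solution of the oscillator whose trajectory remains in M_z ∪ M_v (i.e., for every t ≥ 0, z(t) = 0 or v(t) = 0), then X(t) ∈ E for all t ≥ 0, where E = {(x, z, v) ∈ ℝ³ : h₁(x) = −h₂(z) and v = 0}. In particular, the largest invariant set of the oscillator contained in V̇⁻¹(0) is E. -/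
/-- If the trajectory of a global solution of the oscillator remains in
`M_z ∪ M_v`, then it remains in the set of equilibria `E`. -/
theorem trajectory_in_Mz_union_Mv_mem_E
    (f₁ f₂ g₁ g₂ h₁ h₂ : ℝ → ℝ) (c : ℝ → ℝ → ℝ → ℝ)
    (hf₁lip : LocallyLipschitz f₁) (hf₂lip : LocallyLipschitz f₂)
    (hg₁lip : LocallyLipschitz g₁) (hg₂lip : LocallyLipschitz g₂)
    (hh₁lip : LocallyLipschitz h₁) (hh₂lip : LocallyLipschitz h₂)
    (hh₁mono : StrictMono h₁) (hh₂mono : StrictMono h₂)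
    (hf₁0 : f₁ 0 = 0) (hf₂0 : f₂ 0 = 0) (hg₁0 : g₁ 0 = 0) (hg₂0 : g₂ 0 = 0)
    (hh₁0 : h₁ 0 = 0) (hh₂0 : h₂ 0 = 0)
    (hfneg : ∀ z < (0:ℝ), 0 < f₁ z ∧ f₂ z < 0)
    (hfpos : ∀ z > (0:ℝ), f₁ z < 0 ∧ 0 < f₂ z)
    (hgpos : ∀ v > (0:ℝ), 0 < g₁ v ∧ g₂ v = 0)
    (hgneg : ∀ v < (0:ℝ), g₁ v = 0 ∧ g₂ v < 0)
    (hclip : LocallyLipschitz (fun p : ℝ × ℝ × ℝ => c p.1 p.2.1 p.2.2))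
    (hc0 : ∀ x z : ℝ, c x z 0 = 0)
    (hcv : ∀ x z v : ℝ, 0 ≤ v * c x z v)
    (x z v : ℝ → ℝ)
    (hx : ∀ t ∈ Set.Ici (0:ℝ), HasDerivWithinAt x (v t) (Set.Ici 0) t)
    (hz : ∀ t ∈ Set.Ici (0:ℝ), HasDerivWithinAt z
      (v t + f₁ (z t) * g₁ (v t) + f₂ (z t) * g₂ (v t)) (Set.Ici 0) t)
    (hv : ∀ t ∈ Set.Ici (0:ℝ), HasDerivWithinAt v
      (-h₁ (x t) - h₂ (z t) - c (x t) (z t) (v t)) (Set.Ici 0) t)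
    (hMzv : ∀ t : ℝ, 0 ≤ t → z t = 0 ∨ v t = 0) :
    ∀ t : ℝ, 0 ≤ t → h₁ (x t) = -h₂ (z t) ∧ v t = 0 := by
  have hv_zero : ∀ t : ℝ, 0 ≤ t → v t = 0 := by
    intro t ht
    by_contra hne
    have hev : ∀ᶠ s in nhdsWithin t (Set.Ici 0), z s = 0 := by
      filter_upwards [(hv t ht).continuousWithinAt.eventually_ne hne, self_mem_nhdsWithin]
        with s hs hs0
      exact (hMzv s hs0).resolve_right hs
    have hzt : z t = 0 := (hMzv t ht).resolve_right hne
    have hz_zero : HasDerivWithinAt z 0 (Set.Ici 0) t :=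
      (hasDerivWithinAt_const t (Set.Ici 0) (0 : ℝ)).congr_of_eventuallyEq hev hzt
    have heq := (uniqueDiffOn_Ici (0 : ℝ) t ht).eq_deriv _ (hz t ht) hz_zero
    simp only [hzt, hf₁0, hf₂0, zero_mul, add_zero] at heq
    exact hne heq
  intro t ht
  have hv_deriv : HasDerivWithinAt v 0 (Set.Ici 0) t :=
    (hasDerivWithinAt_const t (Set.Ici 0) (0 : ℝ)).congr hv_zero (hv_zero t ht)
  have heq := (uniqueDiffOn_Ici (0 : ℝ) t ht).eq_deriv _ (hv t ht) hv_deriv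
  rw [hv_zero t ht, hc0] at heq
  exact ⟨by linarith, hv_zero t ht⟩
end

section
/- For every global solution (x, z, v) : [0, +∞) → ℝ³ of the oscillator, the Euclidean distance from (x(t), z(t)) to the set E_xz = {(x, z) ∈ ℝ² : h₁(x) = −h₂(z)} tends to 0 as t → +∞, and v(t) → 0 as t → +∞. -/
open Set Filter Topology

/-- **Barbalat's lemma**: if `F` converges and its derivative is uniformly continuous, then the
derivative tends to zero. -/
lemma tendsto_deriv_zero_of_uniformContinuousOn {F F' : ℝ → ℝ} {l : ℝ}
    (hF : ∀ t ∈ Ici (0 : ℝ), HasDerivWithinAt F (F' t) (Ici 0) t)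
    (hl : Tendsto F atTop (𝓝 l)) (hF' : UniformContinuousOn F' (Ici 0)) :
    Tendsto F' atTop (𝓝 0) := by
  rw [Metric.tendsto_atTop]
  intro ε hε
  obtain ⟨δ, hδ, hδF⟩ := Metric.uniformContinuousOn_iff.1 hF' (ε / 2) (half_pos hε)
  obtain ⟨T, hT⟩ := Metric.tendsto_atTop.1 hl (ε * δ / 8) (by positivity)
  refine ⟨max T 0, fun t ht => ?_⟩
  have htT : T ≤ t := (le_max_left _ _).trans ht
  have ht0 : 0 ≤ t := (le_max_right _ _).trans ht
  obtain ⟨s, hs, hslope⟩ := exists_hasDerivAt_eq_slope F F' (a := t) (b := t + δ / 2) (by linarith)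
    (fun r hr => ((hF r (ht0.trans hr.1)).continuousWithinAt).mono
      (fun u hu => ht0.trans hu.1))
    (fun r hr => (hF r (ht0.trans hr.1.le)).hasDerivAt (Ici_mem_nhds (by linarith [hr.1])))
  have h₁ := hT t htT
  have h₂ := hT (t + δ / 2) (by linarith)
  have h₃ := hδF t ht0 s (ht0.trans hs.1.le)
    (by rw [Real.dist_eq, abs_lt]; constructor <;> linarith [hs.1, hs.2])
  have h₄ : F' s * (δ / 2) = F (t + δ / 2) - F t := by
    rw [hslope, add_sub_cancel_left, div_mul_cancel₀ _ (by positivity)]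
  rw [Real.dist_eq, abs_lt] at *
  have h₅ : F' s < ε / 2 := by
    by_contra! h
    nlinarith
  have h₆ : -(ε / 2) < F' s := by
    by_contra! h
    nlinarith
  constructor <;> linarith

/-- Along a curve in a compact set, if `A` tends to zero then so does every continuous function
vanishing on the zero set of `A`. -/
lemma IsCompact.tendsto_zero_of_zeros_subset {ι E : Type*} [TopologicalSpace E] {K : Set E}
    (hK : IsCompact K) {l : Filter ι} {p : ι → E} (hp : ∀ᶠ t in l, p t ∈ K) {A B : E → ℝ}
    (hA : Continuous A) (hB : Continuous B) (hAB : ∀ q, A q = 0 → B q = 0)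
    (h : Tendsto (fun t => A (p t)) l (𝓝 0)) : Tendsto (fun t => B (p t)) l (𝓝 0) := by
  rw [Metric.tendsto_nhds]
  intro ε hε
  have hS : IsCompact (K ∩ {q | ε ≤ |B q|}) :=
    hK.inter_right (isClosed_le continuous_const hB.abs)
  obtain ⟨m, hm, hmA⟩ : ∃ m > 0, ∀ q ∈ K ∩ {q | ε ≤ |B q|}, m ≤ |A q| := by
    rcases (K ∩ {q | ε ≤ |B q|}).eq_empty_or_nonempty with he | hne
    · exact ⟨1, one_pos, by simp [he]⟩
    · obtain ⟨q, hq, hmin⟩ := hS.exists_isMinOn hne hA.abs.continuousOn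
      refine ⟨|A q|, abs_pos.2 fun h0 => ?_, fun r hr => hmin hr⟩
      have hqε : ε ≤ |B q| := hq.2
      rw [hAB q h0, abs_zero] at hqε
      linarith
  filter_upwards [hp, Metric.tendsto_nhds.1 h m hm] with t htK htm
  rw [Real.dist_0_eq_abs] at *
  by_contra! hlt
  exact absurd (hmA _ ⟨htK, hlt⟩) (not_le.2 htm)

/-- A strictly increasing continuous function vanishing at zero has a nonnegative primitive with
bounded sublevel sets. -/
lemma StrictMono.exists_proper_primitive {h : ℝ → ℝ} (hm : StrictMono h) (hc : Continuous h)
    (h0 : h 0 = 0) : ∃ H : ℝ → ℝ, (∀ x, HasDerivAt H (h x) x) ∧ (∀ x, 0 ≤ H x) ∧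
      ∀ C, ∃ R, ∀ x, H x ≤ C → |x| ≤ R := by
  let H : ℝ → ℝ := fun x => ∫ s in (0 : ℝ)..x, h s
  have hd : ∀ x, HasDerivAt H (h x) x := fun x => hc.integral_hasStrictDerivAt 0 x |>.hasDerivAt
  have hH0 : H 0 = 0 := intervalIntegral.integral_same
  have tangent : ∀ a y, H a + h a * (y - a) ≤ H y := by
    intro a y
    rcases lt_trichotomy a y with hay | rfl | hya
    · obtain ⟨s, hs, he⟩ := exists_hasDerivAt_eq_slope H h hay
        (fun r _ => (hd r).continuousAt.continuousWithinAt) (fun r _ => hd r)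
      rw [eq_div_iff (by linarith)] at he
      nlinarith [hm hs.1]
    · simp
    · obtain ⟨s, hs, he⟩ := exists_hasDerivAt_eq_slope H h hya
        (fun r _ => (hd r).continuousAt.continuousWithinAt) (fun r _ => hd r)
      rw [eq_div_iff (by linarith)] at he
      nlinarith [hm hs.2]
  have hnn : ∀ x, 0 ≤ H x := fun x => by simpa [hH0, h0] using tangent 0 x
  refine ⟨H, hd, hnn, fun C => ⟨1 + C / h 1 + C / (-h (-1)), fun x hx => ?_⟩⟩
  have hp : 0 < h 1 := h0 ▸ hm one_pos
  have hn : 0 < -h (-1) := by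
    have : h (-1) < h 0 := hm (by norm_num)
    linarith
  have hC : 0 ≤ C := (hnn x).trans hx
  have e₁ : x - 1 ≤ C / h 1 := by
    rw [le_div_iff₀ hp]
    linarith [tangent 1 x, hnn 1]
  have e₂ : -x - 1 ≤ C / (-h (-1)) := by
    rw [le_div_iff₀ hn]
    linarith [tangent (-1) x, hnn (-1)]
  have e₃ : 0 ≤ C / h 1 := by positivity
  have e₄ : 0 ≤ C / (-h (-1)) := by positivity
  rw [abs_le]
  constructor <;> linarith

/-- A curve staying in a compact set and following a continuous vector field is uniformly
continuous. -/
lemma IsCompact.uniformContinuousOn_of_hasDerivWithinAt {E : Type*} [NormedAddCommGroup E]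
    [NormedSpace ℝ E] {K : Set E} (hK : IsCompact K) {p : ℝ → E} {V : E → E} (hV : Continuous V)
    (hp : ∀ t ∈ Ici (0 : ℝ), HasDerivWithinAt p (V (p t)) (Ici 0) t)
    (hpK : ∀ t ∈ Ici (0 : ℝ), p t ∈ K) : UniformContinuousOn p (Ici 0) := by
  obtain ⟨C, hC⟩ := hK.exists_bound_of_continuousOn hV.continuousOn
  have := (convex_Ici (0 : ℝ)).lipschitzOnWith_of_nnnorm_hasDerivWithin_le (C := C.toNNReal) hp
    (fun t ht => by
      rw [← NNReal.coe_le_coe, coe_nnnorm]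
      exact (hC _ (hpK t ht)).trans (Real.le_coe_toNNReal C))
  exact this.uniformContinuousOn

/-- The Euclidean distance to a set of points of the plane, as a function of the coordinates. -/
lemma sInf_sqrt_eq_infDist (P : ℝ → ℝ → Prop) (x z : ℝ) :
    sInf {d : ℝ | ∃ a b : ℝ, P a b ∧ d = Real.sqrt ((x - a) ^ 2 + (z - b) ^ 2)} =
      Metric.infDist (!₂[x, z]) {q : EuclideanSpace ℝ (Fin 2) | P (q 0) (q 1)} := by
  rw [Metric.infDist_eq_iInf, ← sInf_image' (f := fun q => dist (!₂[x, z]) q)]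
  congr 1
  ext d
  constructor
  · rintro ⟨a, b, hab, rfl⟩
    exact ⟨!₂[a, b], by simpa using hab, by simp [EuclideanSpace.dist_eq, Real.dist_eq]⟩
  · rintro ⟨q, hq, rfl⟩
    exact ⟨q 0, q 1, hq, by simp [EuclideanSpace.dist_eq, Real.dist_eq]⟩


/-- For every global solution of the oscillator, `(x(t), z(t))` converges to the
set `E_xz = {(x, z) : h₁ x = -h₂ z}` and `v(t) → 0` as `t → +∞`. -/
theorem convergence_to_Exz_and_v_to_zero
    (f₁ f₂ g₁ g₂ h₁ h₂ : ℝ → ℝ) (c : ℝ → ℝ → ℝ → ℝ)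
    (hf₁lip : LocallyLipschitz f₁) (hf₂lip : LocallyLipschitz f₂)
    (hg₁lip : LocallyLipschitz g₁) (hg₂lip : LocallyLipschitz g₂)
    (hh₁lip : LocallyLipschitz h₁) (hh₂lip : LocallyLipschitz h₂)
    (hh₁mono : StrictMono h₁) (hh₂mono : StrictMono h₂)
    (hf₁0 : f₁ 0 = 0) (hf₂0 : f₂ 0 = 0) (hg₁0 : g₁ 0 = 0) (hg₂0 : g₂ 0 = 0)
    (hh₁0 : h₁ 0 = 0) (hh₂0 : h₂ 0 = 0)
    (hfneg : ∀ z < (0:ℝ), 0 < f₁ z ∧ f₂ z < 0)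
    (hfpos : ∀ z > (0:ℝ), f₁ z < 0 ∧ 0 < f₂ z)
    (hgpos : ∀ v > (0:ℝ), 0 < g₁ v ∧ g₂ v = 0)
    (hgneg : ∀ v < (0:ℝ), g₁ v = 0 ∧ g₂ v < 0)
    (hclip : LocallyLipschitz (fun p : ℝ × ℝ × ℝ => c p.1 p.2.1 p.2.2))
    (hc0 : ∀ x z : ℝ, c x z 0 = 0)
    (hcv : ∀ x z v : ℝ, 0 ≤ v * c x z v)
    (x z v : ℝ → ℝ)
    (hx : ∀ t ∈ Set.Ici (0:ℝ), HasDerivWithinAt x (v t) (Set.Ici 0) t)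
    (hz : ∀ t ∈ Set.Ici (0:ℝ), HasDerivWithinAt z
      (v t + f₁ (z t) * g₁ (v t) + f₂ (z t) * g₂ (v t)) (Set.Ici 0) t)
    (hv : ∀ t ∈ Set.Ici (0:ℝ), HasDerivWithinAt v
      (-h₁ (x t) - h₂ (z t) - c (x t) (z t) (v t)) (Set.Ici 0) t)
    :
    Filter.Tendsto (fun t => sInf {d : ℝ | ∃ a b : ℝ, h₁ a = -h₂ b ∧
        d = Real.sqrt ((x t - a) ^ 2 + (z t - b) ^ 2)})
      Filter.atTop (nhds 0) ∧
    Filter.Tendsto v Filter.atTop (nhds 0) := by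
  have cf₁ := hf₁lip.continuous
  have cf₂ := hf₂lip.continuous
  have cg₁ := hg₁lip.continuous
  have cg₂ := hg₂lip.continuous
  have ch₁ := hh₁lip.continuous
  have ch₂ := hh₂lip.continuous
  have cc := hclip.continuous
  -- the hysteretic term, the acceleration and the dissipation rate as functions of the state
  let φ : ℝ × ℝ × ℝ → ℝ := fun q => f₁ q.2.1 * g₁ q.2.2 + f₂ q.2.1 * g₂ q.2.2
  let N : ℝ × ℝ × ℝ → ℝ := fun q => -h₁ q.1 - h₂ q.2.1 - c q.1 q.2.1 q.2.2
  let D : ℝ × ℝ × ℝ → ℝ := fun q => h₂ q.2.1 * φ q - q.2.2 * c q.1 q.2.1 q.2.2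
  have cφ : Continuous φ := by fun_prop
  have cN : Continuous N := by fun_prop
  have cD : Continuous D := by fun_prop
  have φ_zero : ∀ q : ℝ × ℝ × ℝ, q.2.1 * q.2.2 = 0 → φ q = 0 := by
    rintro ⟨a, b, w⟩ h
    rcases mul_eq_zero.1 h with h | h <;> simp only at h <;> subst h <;> simp [φ, *]
  have hφ_neg : ∀ q : ℝ × ℝ × ℝ, q.2.1 * q.2.2 ≠ 0 → h₂ q.2.1 * φ q < 0 := by
    rintro ⟨a, b, w⟩ h
    obtain ⟨hb, hw⟩ := mul_ne_zero_iff.1 h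
    simp only at hb hw
    simp only [φ]
    rcases lt_or_gt_of_ne hb with hb | hb <;> rcases lt_or_gt_of_ne hw with hw | hw
    · have := hh₂mono hb
      have := mul_pos_of_neg_of_neg (hfneg b hb).2 (hgneg w hw).2
      rw [(hgneg w hw).1]
      nlinarith
    · have := hh₂mono hb
      have := mul_pos (hfneg b hb).1 (hgpos w hw).1
      rw [(hgpos w hw).2]
      nlinarith
    · have := hh₂mono hb
      have := mul_neg_of_pos_of_neg (hfpos b hb).2 (hgneg w hw).2
      rw [(hgneg w hw).1]
      nlinarith
    · have := hh₂mono hb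
      have := mul_neg_of_neg_of_pos (hfpos b hb).1 (hgpos w hw).1
      rw [(hgpos w hw).2]
      nlinarith
  have D_nonpos : ∀ q, D q ≤ 0 := by
    intro q
    have hc := hcv q.1 q.2.1 q.2.2
    by_cases h : q.2.1 * q.2.2 = 0
    · simp only [D, φ_zero q h]
      linarith
    · have := hφ_neg q h
      simp only [D]
      linarith
  have D_zero : ∀ q, D q = 0 → q.2.1 * q.2.2 = 0 := by
    intro q hq
    by_contra h
    have := hφ_neg q h
    have hc := hcv q.1 q.2.1 q.2.2
    simp only [D] at hq
    linarith
  let p : ℝ → ℝ × ℝ × ℝ := fun t => (x t, z t, v t)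
  have hz' : ∀ t ∈ Ici (0 : ℝ), HasDerivWithinAt z (v t + φ (p t)) (Ici 0) t := by
    intro t ht
    have := hz t ht
    rwa [add_assoc] at this
  have hv' : ∀ t ∈ Ici (0 : ℝ), HasDerivWithinAt v (N (p t)) (Ici 0) t := hv
  have hp : ∀ t ∈ Ici (0 : ℝ),
      HasDerivWithinAt p ((fun q => (q.2.2, q.2.2 + φ q, N q)) (p t)) (Ici 0) t :=
    fun t ht => (hx t ht).prodMk ((hz' t ht).prodMk (hv' t ht))
  obtain ⟨H₁, dH₁, H₁_nonneg, H₁_proper⟩ := hh₁mono.exists_proper_primitive ch₁ hh₁0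
  obtain ⟨H₂, dH₂, H₂_nonneg, H₂_proper⟩ := hh₂mono.exists_proper_primitive ch₂ hh₂0
  -- the energy
  let W : ℝ → ℝ := fun t => H₁ (x t) + H₂ (z t) + v t ^ 2 / 2
  have dW : ∀ t ∈ Ici (0 : ℝ), HasDerivWithinAt W (D (p t)) (Ici 0) t := by
    intro t ht
    have := (((dH₁ (x t)).comp_hasDerivWithinAt t (hx t ht)).add
      ((dH₂ (z t)).comp_hasDerivWithinAt t (hz' t ht))).add (((hv' t ht).pow 2).div_const 2)
    refine this.congr_deriv ?_
    simp only [D, N, p]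
    push_cast
    ring
  have W_anti : AntitoneOn W (Ici 0) := by
    refine antitoneOn_of_hasDerivWithinAt_nonpos (convex_Ici 0)
      (fun t ht => (dW t ht).continuousWithinAt)
      (fun t ht => (dW t (interior_subset ht)).mono interior_subset) (fun t _ => D_nonpos _)
  have W_nonneg : ∀ t, 0 ≤ W t := fun t => by
    have := H₁_nonneg (x t)
    have := H₂_nonneg (z t)
    positivity
  obtain ⟨l, W_tendsto⟩ : ∃ l, Tendsto W atTop (𝓝 l) := by
    have anti : Antitone fun t => W (max t 0) := fun s t hst =>
      W_anti (mem_Ici.2 (le_max_right _ _)) (mem_Ici.2 (le_max_right _ _)) (max_le_max_right 0 hst)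
    refine ⟨_, (tendsto_atTop_ciInf anti ⟨0, ?_⟩).congr' ?_⟩
    · rintro _ ⟨t, rfl⟩
      exact W_nonneg _
    · filter_upwards [eventually_ge_atTop 0] with t ht
      rw [max_eq_left ht]
  obtain ⟨K, hK, hpK⟩ : ∃ K : Set (ℝ × ℝ × ℝ), IsCompact K ∧ ∀ t ∈ Ici (0 : ℝ), p t ∈ K := by
    obtain ⟨R₁, hR₁⟩ := H₁_proper (W 0)
    obtain ⟨R₂, hR₂⟩ := H₂_proper (W 0)
    refine ⟨Icc (-R₁) R₁ ×ˢ Icc (-R₂) R₂ ×ˢ Icc (-(1 + W 0)) (1 + W 0),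
      isCompact_Icc.prod (isCompact_Icc.prod isCompact_Icc), fun t ht => ?_⟩
    have hW : H₁ (x t) + H₂ (z t) + v t ^ 2 / 2 ≤ W 0 := W_anti self_mem_Ici ht ht
    have e₁ := H₁_nonneg (x t)
    have e₂ := H₂_nonneg (z t)
    have e₃ := sq_nonneg (v t)
    refine ⟨abs_le.1 (hR₁ _ (by linarith)), abs_le.1 (hR₂ _ (by linarith)), ?_, ?_⟩ <;>
      simp only [p] <;> nlinarith [sq_nonneg (v t - 1), sq_nonneg (v t + 1)]
  have hpK' : ∀ᶠ t in atTop, p t ∈ K := (eventually_ge_atTop 0).mono hpK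
  have hpu : UniformContinuousOn p (Ici 0) :=
    hK.uniformContinuousOn_of_hasDerivWithinAt (V := fun q => (q.2.2, q.2.2 + φ q, N q))
      (by fun_prop) hp hpK
  have huc : ∀ G : ℝ × ℝ × ℝ → ℝ, Continuous G →
      UniformContinuousOn (fun t => G (p t)) (Ici 0) := fun G hG =>
    (hK.uniformContinuousOn_of_continuous hG.continuousOn).comp hpu hpK
  have D_tendsto : Tendsto (fun t => D (p t)) atTop (𝓝 0) :=
    tendsto_deriv_zero_of_uniformContinuousOn dW W_tendsto (huc D cD)
  have zv_tendsto : Tendsto (fun t => z t * v t) atTop (𝓝 0) :=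
    hK.tendsto_zero_of_zeros_subset (B := fun q => q.2.1 * q.2.2) hpK' cD (by fun_prop) D_zero
      D_tendsto
  have dzv_tendsto : Tendsto (fun t => (v t + φ (p t)) * v t + z t * N (p t)) atTop (𝓝 0) :=
    tendsto_deriv_zero_of_uniformContinuousOn (fun t ht => (hz' t ht).mul (hv' t ht)) zv_tendsto
      (huc (fun q => (q.2.2 + φ q) * q.2.2 + q.2.1 * N q) (by fun_prop))
  have v_tendsto : Tendsto v atTop (𝓝 0) := by
    refine hK.tendsto_zero_of_zeros_subset (p := p)
      (A := fun q => |q.2.1 * q.2.2| + |(q.2.2 + φ q) * q.2.2 + q.2.1 * N q|)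
      (B := fun q => q.2.2) hpK' (by fun_prop) (by fun_prop) ?_ ?_
    · intro q hq
      obtain ⟨e₁, e₂⟩ := (add_eq_zero_iff_of_nonneg (abs_nonneg _) (abs_nonneg _)).1 hq
      rw [abs_eq_zero] at e₁ e₂
      rw [φ_zero q e₁] at e₂
      rcases mul_eq_zero.1 e₁ with h | h
      · simpa [h] using e₂
      · exact h
    · simpa using zv_tendsto.abs.add dzv_tendsto.abs
  have N_tendsto : Tendsto (fun t => N (p t)) atTop (𝓝 0) :=
    tendsto_deriv_zero_of_uniformContinuousOn hv' v_tendsto (huc N cN)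
  refine ⟨?_, v_tendsto⟩
  simp_rw [sInf_sqrt_eq_infDist (fun a b => h₁ a = -h₂ b)]
  refine hK.tendsto_zero_of_zeros_subset (p := p) (A := fun q => |q.2.2| + |N q|)
    (B := fun q => Metric.infDist (!₂[q.1, q.2.1])
      {r : EuclideanSpace ℝ (Fin 2) | h₁ (r 0) = -h₂ (r 1)}) hpK' (by fun_prop) ?_ ?_ ?_
  · exact (Metric.continuous_infDist_pt _).comp (by fun_prop)
  · intro q hq
    obtain ⟨e₁, e₂⟩ := (add_eq_zero_iff_of_nonneg (abs_nonneg _) (abs_nonneg _)).1 hq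
    rw [abs_eq_zero] at e₁ e₂
    refine Metric.infDist_zero_of_mem ?_
    simp only [N, e₁, hc0] at e₂
    simp only [mem_ofPred_eq, Matrix.cons_val_zero, Matrix.cons_val_one]
    linarith
  · simpa using v_tendsto.abs.add N_tendsto.abs
end

section
/- Let H : ℝ → ℝ be a strictly decreasing continuous function with H(0) = 0, and define J : ℝ → ℝ by J(y) = dist((0, y), G(H)), the Euclidean distance in ℝ² from (0, y) to the graph G(H) = {(x, H(x)) : x ∈ ℝ}. Then: (i) J is continuous; (ii) J(0) = 0 and J(y) > 0 for all y ≠ 0; (iii) for every y ∈ ℝ the distance is attained, i.e., J(y) = dist((0, y), (a, H(a))) for some a ∈ ℝ with a ≤ 0 and H(a) ≥ 0 if y ≥ 0, and with a ≥ 0 and H(a) ≤ 0 if y ≤ 0; (iv) J is nondecreasing on [0, +∞) and nonincreasing on (−∞, 0]. -/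
open Set in
/-- For `0 ≤ y`, a point of the graph of `H` nearest to `(0, y)` is found over `[-y, 0]`. -/
theorem exists_nearest_graph_point_of_nonneg {H : ℝ → ℝ} (hH : Antitone H)
    (hc : Continuous H) (h0 : H 0 = 0) {y : ℝ} (hy : 0 ≤ y) :
    ∃ a, -y ≤ a ∧ a ≤ 0 ∧ 0 ≤ H a ∧
      ∀ b, a ^ 2 + (y - H a) ^ 2 ≤ b ^ 2 + (y - H b) ^ 2 := by
  have hmem : (0 : ℝ) ∈ Icc (-y) 0 := ⟨by linarith, le_rfl⟩
  obtain ⟨a, ha, hmin⟩ := isCompact_Icc.exists_isMinOn ⟨0, hmem⟩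
    (f := fun a => a ^ 2 + (y - H a) ^ 2) (by fun_prop)
  refine ⟨a, ha.1, ha.2, h0 ▸ hH ha.2, fun b => ?_⟩
  have hzero : a ^ 2 + (y - H a) ^ 2 ≤ y ^ 2 := by simpa [h0] using hmin hmem
  rcases lt_or_ge b (-y) with hb | hb
  · nlinarith [sq_nonneg (y - H b)]
  rcases le_or_gt b 0 with hb' | hb'
  · exact hmin ⟨hb, hb'⟩
  · have : H b ≤ 0 := h0 ▸ hH hb'.le
    nlinarith [sq_nonneg b]

open Set in
/-- The squared distance from `(0, y)` to any point of the graph of `H` over `(-∞, 0]` bounds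
that of a suitable graph point from `(0, x)`, when `0 ≤ x ≤ y`. -/
theorem exists_graph_point_closer_of_le {H : ℝ → ℝ} (hc : Continuous H) (h0 : H 0 = 0)
    {x y a : ℝ} (hx : 0 ≤ x) (hxy : x ≤ y) (ha : a ≤ 0) :
    ∃ b, b ^ 2 + (x - H b) ^ 2 ≤ a ^ 2 + (y - H a) ^ 2 := by
  rcases le_or_gt (H a) x with h | h
  · exact ⟨a, by nlinarith⟩
  · obtain ⟨b, hb, hbx⟩ := intermediate_value_Icc' ha hc.continuousOn
      (show x ∈ Icc (H 0) (H a) from ⟨by linarith, h.le⟩)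
    refine ⟨b, ?_⟩
    rw [hbx]
    nlinarith [hb.1, hb.2, sq_nonneg (y - H a)]

/-- The distance from `(0, y)` to a fixed point is `1`-Lipschitz in `y`. -/
theorem sqrt_sq_add_sq_sub_le (a c y z : ℝ) :
    √(a ^ 2 + (y - c) ^ 2) ≤ √(a ^ 2 + (z - c) ^ 2) + |y - z| := by
  have hz : |z - c| ≤ √(a ^ 2 + (z - c) ^ 2) := Real.abs_le_sqrt (by nlinarith)
  have hs := Real.sq_sqrt (show 0 ≤ a ^ 2 + (z - c) ^ 2 by positivity)
  refine Real.sqrt_le_iff.2 ⟨by positivity, ?_⟩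
  have hm : (z - c) * (y - z) ≤ √(a ^ 2 + (z - c) ^ 2) * |y - z| :=
    (le_abs_self _).trans ((abs_mul _ _).trans_le (by gcongr))
  nlinarith [sq_abs (y - z)]

/-- Properties of the distance from `(0, y)` to the graph of a strictly
decreasing continuous function `H` with `H 0 = 0`. -/
theorem dist_to_graph_of_strictAnti_vert
    (H : ℝ → ℝ) (hH : StrictAnti H) (hHcont : Continuous H) (hH0 : H 0 = 0)
    (J : ℝ → ℝ)
    (hJ : ∀ y : ℝ, J y = sInf {d : ℝ | ∃ a : ℝ,
      d = Real.sqrt (a ^ 2 + (y - H a) ^ 2)}) :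
    Continuous J ∧
    J 0 = 0 ∧
    (∀ y : ℝ, y ≠ 0 → 0 < J y) ∧
    (∀ y : ℝ, ∃ a : ℝ, J y = Real.sqrt (a ^ 2 + (y - H a) ^ 2) ∧
      (0 ≤ y → a ≤ 0 ∧ 0 ≤ H a) ∧ (y ≤ 0 → 0 ≤ a ∧ H a ≤ 0)) ∧
    MonotoneOn J (Set.Ici 0) ∧
    AntitoneOn J (Set.Iic 0) := by
  have hK : Antitone fun x => -H (-x) := fun x y h => neg_le_neg (hH.antitone (neg_le_neg h))
  have hKc : Continuous fun x => -H (-x) := by fun_prop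
  have hK0 : (fun x => -H (-x)) 0 = 0 := by simp [hH0]
  have hreflect (a y : ℝ) :
      a ^ 2 + (-y - -H (-a)) ^ 2 = (-a) ^ 2 + (y - H (-a)) ^ 2 := by ring
  have hle (y a : ℝ) : J y ≤ √(a ^ 2 + (y - H a) ^ 2) := by
    rw [hJ]
    exact csInf_le ⟨0, by rintro _ ⟨b, rfl⟩; positivity⟩ ⟨a, rfl⟩
  have heq {y a : ℝ} (h : ∀ b, a ^ 2 + (y - H a) ^ 2 ≤ b ^ 2 + (y - H b) ^ 2) :
      J y = √(a ^ 2 + (y - H a) ^ 2) := by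
    refine le_antisymm (hle y a) ?_
    rw [hJ]
    refine le_csInf ⟨_, a, rfl⟩ ?_
    rintro _ ⟨b, rfl⟩
    exact Real.sqrt_le_sqrt (h b)
  have hatt (y : ℝ) : ∃ a : ℝ, J y = √(a ^ 2 + (y - H a) ^ 2) ∧
      (0 ≤ y → a ≤ 0 ∧ 0 ≤ H a) ∧ (y ≤ 0 → 0 ≤ a ∧ H a ≤ 0) := by
    rcases le_or_gt 0 y with hy | hy
    · obtain ⟨a, h1, h2, h3, h4⟩ :=
        exists_nearest_graph_point_of_nonneg hH.antitone hHcont hH0 hy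
      refine ⟨a, heq h4, fun _ => ⟨h2, h3⟩, fun hy' => ?_⟩
      have ha : 0 ≤ a := by linarith
      exact ⟨ha, hH0 ▸ hH.antitone ha⟩
    · obtain ⟨a, h1, h2, h3, h4⟩ :=
        exists_nearest_graph_point_of_nonneg hK hKc hK0 (neg_nonneg.2 hy.le)
      refine ⟨-a, heq fun b => ?_, fun hy' => absurd hy hy'.not_gt,
        fun _ => ⟨by linarith, by linarith⟩⟩
      have hb := h4 (-b)
      rwa [hreflect, hreflect, neg_neg] at hb
  have hlip (y z : ℝ) : J y ≤ J z + |y - z| := by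
    obtain ⟨a, ha, -⟩ := hatt z
    rw [ha]
    exact (hle y a).trans (sqrt_sq_add_sq_sub_le a (H a) y z)
  refine ⟨?_, ?_, fun y hy => ?_, hatt, fun x hx y hy hxy => ?_, fun x hx y hy hxy => ?_⟩
  · refine (LipschitzWith.of_le_add_mul 1 fun y z => ?_).continuous
    simpa [Real.dist_eq] using hlip y z
  · obtain ⟨a, ha, h1, h2⟩ := hatt 0
    obtain rfl : a = 0 := le_antisymm (h1 le_rfl).1 (h2 le_rfl).1
    simpa [hH0] using ha
  · obtain ⟨a, ha, -⟩ := hatt y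
    rw [ha, Real.sqrt_pos]
    by_cases h : a = 0
    · subst h
      simpa [hH0] using pow_pos (abs_pos.2 hy) 2
    · positivity
  · obtain ⟨a, ha, h1, -⟩ := hatt y
    obtain ⟨b, hb⟩ := exists_graph_point_closer_of_le hHcont hH0 hx hxy (h1 hy).1
    rw [ha]
    exact (hle x b).trans (Real.sqrt_le_sqrt hb)
  · obtain ⟨a, ha, -, h2⟩ := hatt x
    obtain ⟨b, hb⟩ := exists_graph_point_closer_of_le hKc hK0 (neg_nonneg.2 hy)
      (neg_le_neg hxy) (neg_nonpos.2 (h2 hx).1)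
    rw [ha]
    rw [hreflect, hreflect, neg_neg] at hb
    exact (hle y (-b)).trans (Real.sqrt_le_sqrt hb)
end

section
/- Let X : [0, +∞) → ℝ³ be a global solution of the oscillator. If X is eventually in N_ne or eventually in N_sw (i.e., there exists T ≥ 0 such that X(t) ∈ N_ne for all t > T, or there exists T ≥ 0 such that X(t) ∈ N_sw for all t > T), then X(t) → 0 as t → +∞. -/
open Filter Topology Set

/-- A mean value inequality with an upper bound on the derivative on `[a, b]`. -/
theorem sub_le_mul_sub_of_hasDerivAt_le {f f' : ℝ → ℝ} {a b C : ℝ} (hab : a ≤ b)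
    (hf : ∀ s ∈ Icc a b, HasDerivAt f (f' s) s) (hC : ∀ s ∈ Icc a b, f' s ≤ C) :
    f b - f a ≤ C * (b - a) := by
  refine (convex_Icc a b).image_sub_le_mul_sub_of_deriv_le
    (fun s hs => (hf s hs).continuousAt.continuousWithinAt)
    (fun s hs => (hf s (interior_subset hs)).differentiableAt.differentiableWithinAt)
    (fun s hs => ?_) a (left_mem_Icc.2 hab) b (right_mem_Icc.2 hab) hab
  rw [(hf s (interior_subset hs)).deriv]
  exact hC s (interior_subset hs)

/-- A nonnegative function with nonpositive derivative on `[a, ∞)` has a nonnegative limit. -/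
theorem exists_tendsto_of_hasDerivAt_nonpos {f f' : ℝ → ℝ} {a : ℝ}
    (hf : ∀ s ≥ a, HasDerivAt f (f' s) s) (hf' : ∀ s ≥ a, f' s ≤ 0) (h0 : ∀ s ≥ a, 0 ≤ f s) :
    ∃ l, 0 ≤ l ∧ Tendsto f atTop (𝓝 l) := by
  have hanti : Antitone fun t => f (max t a) := by
    intro s t hst
    have := sub_le_mul_sub_of_hasDerivAt_le (max_le_max_right a hst)
      (fun u hu => hf u ((le_max_right s a).trans hu.1))
      (fun u hu => hf' u ((le_max_right s a).trans hu.1))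
    simp only
    linarith
  have hbdd : BddBelow (range fun t => f (max t a)) :=
    ⟨0, by rintro _ ⟨t, rfl⟩; exact h0 _ (le_max_right t a)⟩
  have hlim := (tendsto_atTop_ciInf hanti hbdd).congr'
    (f₂ := f) (by filter_upwards [eventually_ge_atTop a] with t ht; rw [max_eq_left ht])
  exact ⟨_, ge_of_tendsto hlim (by filter_upwards [eventually_ge_atTop a] with t ht using h0 t ht),
    hlim⟩

/-- A one-sided Barbalat lemma: if `x` converges and its derivative `v` is nonpositive with
`v'` bounded below, then `v` tends to `0`. -/
theorem tendsto_zero_of_tendsto_of_hasDerivAt {x v v' : ℝ → ℝ} {a l M : ℝ}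
    (hx : ∀ t ≥ a, HasDerivAt x (v t) t) (hv : ∀ t ≥ a, HasDerivAt v (v' t) t)
    (hv0 : ∀ t ≥ a, v t ≤ 0) (hM : ∀ t ≥ a, -M ≤ v' t) (hl : Tendsto x atTop (𝓝 l)) :
    Tendsto v atTop (𝓝 0) := by
  have key : ∀ s > 0, ∀ t ≥ a + s, (x t - x (t - s)) / s - |M| * s ≤ v t := by
    intro s hs t ht
    have hbound : ∀ u ∈ Icc (t - s) t, v u ≤ v t + |M| * s := by
      intro u hu
      have h := sub_le_mul_sub_of_hasDerivAt_le (f := fun t => -v t) (f' := fun t => -v' t)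
        (C := |M|) hu.2 (fun r hr => (hv r (by linarith [hr.1, hu.1])).neg)
        (fun r hr => by linarith [hM r (by linarith [hr.1, hu.1]), le_abs_self M])
      have : |M| * (t - u) ≤ |M| * s := by
        gcongr
        linarith [hu.1]
      linarith
    have h := sub_le_mul_sub_of_hasDerivAt_le (show t - s ≤ t by linarith)
      (fun u hu => hx u (by linarith [hu.1])) hbound
    rw [sub_sub_cancel] at h
    have := (div_le_iff₀ hs).2 h
    linarith
  rw [Metric.tendsto_atTop']
  intro ε hε
  obtain ⟨s, hs, hsε⟩ : ∃ s > 0, |M| * s < ε / 2 :=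
    ⟨ε / (2 * (|M| + 1)), by positivity, by
      rw [← mul_div_assoc, div_lt_div_iff₀ (by positivity) (by positivity)]
      nlinarith [abs_nonneg M]⟩
  have hdiff : Tendsto (fun t => (x t - x (t - s)) / s) atTop (𝓝 0) := by
    have h := (hl.sub (hl.comp (tendsto_atTop_add_const_right _ (-s) tendsto_id))).div_const s
    simpa [sub_eq_add_neg] using h
  have hev := hdiff.eventually (lt_mem_nhds (show -(ε / 2) < 0 by linarith))
  obtain ⟨b, hb⟩ := (hev.and (eventually_ge_atTop (a + s))).exists_forall_of_atTop
  refine ⟨b, fun t ht => ?_⟩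
  obtain ⟨h1, h2⟩ := hb t ht.le
  have h3 := key s hs t h2
  have h4 := hv0 t (by linarith)
  rw [Real.dist_eq, sub_zero, abs_lt]
  constructor <;> linarith

/-- If both a function and its derivative converge at infinity, the derivative cannot have a
negative limit. -/
theorem nonneg_of_tendsto_of_hasDerivAt {v v' : ℝ → ℝ} {a l m : ℝ}
    (hv : ∀ t ≥ a, HasDerivAt v (v' t) t) (hl : Tendsto v atTop (𝓝 l))
    (hm : Tendsto v' atTop (𝓝 m)) : 0 ≤ m := by
  by_contra! hneg
  have hev := hm.eventually (gt_mem_nhds (show m < m / 2 by linarith))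
  obtain ⟨b, hb⟩ := hev.exists_forall_of_atTop
  have hstep : ∀ t ≥ max a b, v (t + 1) - v t ≤ m / 2 := by
    intro t ht
    have hta := (le_max_left a b).trans ht
    have htb := (le_max_right a b).trans ht
    have := sub_le_mul_sub_of_hasDerivAt_le (show t ≤ t + 1 by linarith)
      (fun s hs => hv s (hta.trans hs.1)) (fun s hs => (hb s (htb.trans hs.1)).le)
    linarith
  have hdiff := (hl.comp (tendsto_atTop_add_const_right _ (1 : ℝ) tendsto_id)).sub hl
  have := le_of_tendsto hdiff ((eventually_ge_atTop (max a b)).mono hstep)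
  linarith

/-- Convergence to the origin for trajectories that stay in the positive quadrant of the
`(x, z)`-plane after time `T`. Of the equation for `z`, only `z' ≤ 0` where `v ≤ 0` is needed. -/
theorem tendsto_zero_of_pos {h₁ h₂ : ℝ → ℝ} {c : ℝ → ℝ → ℝ → ℝ}
    (hh₁ : Continuous h₁) (hh₂ : Continuous h₂)
    (hh₁mono : StrictMono h₁) (hh₂mono : StrictMono h₂) (hh₁0 : h₁ 0 = 0) (hh₂0 : h₂ 0 = 0)
    (hc : Continuous fun p : ℝ × ℝ × ℝ => c p.1 p.2.1 p.2.2)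
    (hc0 : ∀ x z : ℝ, c x z 0 = 0) (hcv : ∀ x z v : ℝ, 0 ≤ v * c x z v)
    {x z v w : ℝ → ℝ} {T : ℝ}
    (hx : ∀ t > T, HasDerivAt x (v t) t) (hz : ∀ t > T, HasDerivAt z (w t) t)
    (hw : ∀ t > T, v t ≤ 0 → w t ≤ 0)
    (hv : ∀ t > T, HasDerivAt v (-h₁ (x t) - h₂ (z t) - c (x t) (z t) (v t)) t)
    (hpos : ∀ t > T, 0 < x t ∧ 0 < z t) :
    Tendsto x atTop (𝓝 0) ∧ Tendsto z atTop (𝓝 0) ∧ Tendsto v atTop (𝓝 0) := by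
  have hh₁pos : ∀ {y}, 0 < y → 0 < h₁ y := fun hy => hh₁0 ▸ hh₁mono hy
  have hh₂pos : ∀ {y}, 0 < y → 0 < h₂ y := fun hy => hh₂0 ▸ hh₂mono hy
  have hcnonneg : ∀ {x z v}, 0 < v → 0 ≤ c x z v := fun {x z v} h =>
    nonneg_of_mul_nonneg_right (hcv x z v) h
  have hcnonpos : ∀ {x z v}, v ≤ 0 → c x z v ≤ 0 := by
    intro x z v h
    rcases h.eq_or_lt with rfl | h
    · exact (hc0 x z).le
    · nlinarith [hcv x z v]
  obtain ⟨a, haT, ha⟩ : ∃ a > T, v a ≤ 0 := by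
    by_contra! hvpos
    have hT : T < T + 1 := by linarith
    have hδ := hh₁pos (hpos (T + 1) hT).1
    set δ := h₁ (x (T + 1)) with hδdef
    have hv' : ∀ t ≥ T + 1, -h₁ (x t) - h₂ (z t) - c (x t) (z t) (v t) ≤ -δ := by
      intro t ht
      have hxt := sub_le_mul_sub_of_hasDerivAt_le (f := fun t => -x t) (f' := fun t => -v t)
        (C := 0) ht (fun s hs => (hx s (by linarith [hs.1])).neg)
        (fun s hs => by linarith [hvpos s (by linarith [hs.1])])
      have h1 : δ ≤ h₁ (x t) := hh₁mono.monotone (by linarith)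
      have h2 := hh₂pos (hpos t (by linarith)).2
      have h3 : 0 ≤ c (x t) (z t) (v t) := hcnonneg (hvpos t (by linarith))
      linarith
    have hb : T + 1 ≤ T + 1 + v (T + 1) / δ := by
      have := hvpos (T + 1) hT
      have : 0 < v (T + 1) / δ := by positivity
      linarith
    have h := sub_le_mul_sub_of_hasDerivAt_le hb (fun s hs => hv s (by linarith [hs.1]))
      (fun s hs => hv' s hs.1)
    have h' := hvpos (T + 1 + v (T + 1) / δ) (by linarith)
    rw [add_sub_cancel_left, neg_mul, mul_div_cancel₀ _ hδ.ne'] at h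
    linarith
  have hvnonpos : ∀ t ≥ a, v t ≤ 0 := by
    intro t ht
    refine image_le_of_deriv_right_lt_deriv_boundary (a := a) (b := t) (B := fun _ => 0)
      (B' := fun _ => 0)
      (fun s hs => (hv s (haT.trans_le hs.1)).continuousAt.continuousWithinAt)
      (fun s hs => (hv s (haT.trans_le hs.1)).hasDerivWithinAt) ha
      (fun s => hasDerivAt_const s 0) (fun s hs hs0 => ?_) (right_mem_Icc.2 ht)
    have hs' := hpos s (haT.trans_le hs.1)
    rw [hs0, hc0]
    linarith [hh₁pos hs'.1, hh₂pos hs'.2]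
  have hT : ∀ t ≥ a, T < t := fun t ht => haT.trans_le ht
  obtain ⟨l, hl0, hl⟩ := exists_tendsto_of_hasDerivAt_nonpos (fun t ht => hx t (hT t ht)) hvnonpos
    (fun t ht => (hpos t (hT t ht)).1.le)
  obtain ⟨m, hm0, hm⟩ := exists_tendsto_of_hasDerivAt_nonpos (fun t ht => hz t (hT t ht))
    (fun t ht => hw t (hT t ht) (hvnonpos t ht)) (fun t ht => (hpos t (hT t ht)).2.le)
  have hxa : ∀ t ≥ a, x t ≤ x a := fun t ht => by
    have := sub_le_mul_sub_of_hasDerivAt_le ht (fun s hs => hx s (hT s hs.1))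
      (fun s hs => hvnonpos s hs.1)
    linarith
  have hza : ∀ t ≥ a, z t ≤ z a := fun t ht => by
    have := sub_le_mul_sub_of_hasDerivAt_le ht (fun s hs => hz s (hT s hs.1))
      (fun s hs => hw s (hT s hs.1) (hvnonpos s hs.1))
    linarith
  have hv0 : Tendsto v atTop (𝓝 0) :=
    tendsto_zero_of_tendsto_of_hasDerivAt (M := h₁ (x a) + h₂ (z a))
      (fun t ht => hx t (hT t ht)) (fun t ht => hv t (hT t ht)) hvnonpos
      (fun t ht => by
        have h1 := hh₁mono.monotone (hxa t ht)
        have h2 := hh₂mono.monotone (hza t ht)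
        have h3 : c (x t) (z t) (v t) ≤ 0 := hcnonpos (hvnonpos t ht)
        linarith) hl
  have hclim : Tendsto (fun t => c (x t) (z t) (v t)) atTop (𝓝 0) := by
    have h := (hc.tendsto (l, m, 0)).comp (hl.prodMk_nhds (hm.prodMk_nhds hv0))
    simpa only [hc0, Function.comp_def] using h
  have hlim := nonneg_of_tendsto_of_hasDerivAt (fun t ht => hv t (hT t ht)) hv0
    ((((hh₁.tendsto l).comp hl).neg.sub ((hh₂.tendsto m).comp hm)).sub hclim)
  have h1 : 0 ≤ h₁ l := hh₁0 ▸ hh₁mono.monotone hl0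
  have h2 : 0 ≤ h₂ m := hh₂0 ▸ hh₂mono.monotone hm0
  have hl' : l = 0 := hh₁mono.injective (by linarith)
  have hm' : m = 0 := hh₂mono.injective (by linarith)
  exact ⟨hl' ▸ hl, hm' ▸ hm, hv0⟩


/-- If a global solution of the oscillator is eventually in `N_ne` or
eventually in `N_sw`, then it converges to the origin. -/
theorem eventually_Nne_or_Nsw_tendsto_zero
    (f₁ f₂ g₁ g₂ h₁ h₂ : ℝ → ℝ) (c : ℝ → ℝ → ℝ → ℝ)
    (hf₁lip : LocallyLipschitz f₁) (hf₂lip : LocallyLipschitz f₂)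
    (hg₁lip : LocallyLipschitz g₁) (hg₂lip : LocallyLipschitz g₂)
    (hh₁lip : LocallyLipschitz h₁) (hh₂lip : LocallyLipschitz h₂)
    (hh₁mono : StrictMono h₁) (hh₂mono : StrictMono h₂)
    (hf₁0 : f₁ 0 = 0) (hf₂0 : f₂ 0 = 0) (hg₁0 : g₁ 0 = 0) (hg₂0 : g₂ 0 = 0)
    (hh₁0 : h₁ 0 = 0) (hh₂0 : h₂ 0 = 0)
    (hfneg : ∀ z < (0:ℝ), 0 < f₁ z ∧ f₂ z < 0)
    (hfpos : ∀ z > (0:ℝ), f₁ z < 0 ∧ 0 < f₂ z)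
    (hgpos : ∀ v > (0:ℝ), 0 < g₁ v ∧ g₂ v = 0)
    (hgneg : ∀ v < (0:ℝ), g₁ v = 0 ∧ g₂ v < 0)
    (hclip : LocallyLipschitz (fun p : ℝ × ℝ × ℝ => c p.1 p.2.1 p.2.2))
    (hc0 : ∀ x z : ℝ, c x z 0 = 0)
    (hcv : ∀ x z v : ℝ, 0 ≤ v * c x z v)
    (x z v : ℝ → ℝ)
    (hx : ∀ t ∈ Set.Ici (0:ℝ), HasDerivWithinAt x (v t) (Set.Ici 0) t)
    (hz : ∀ t ∈ Set.Ici (0:ℝ), HasDerivWithinAt z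
      (v t + f₁ (z t) * g₁ (v t) + f₂ (z t) * g₂ (v t)) (Set.Ici 0) t)
    (hv : ∀ t ∈ Set.Ici (0:ℝ), HasDerivWithinAt v
      (-h₁ (x t) - h₂ (z t) - c (x t) (z t) (v t)) (Set.Ici 0) t)
    (hN : (∃ T ≥ (0:ℝ), ∀ t > T, 0 < x t ∧ 0 < z t) ∨
          (∃ T ≥ (0:ℝ), ∀ t > T, x t < 0 ∧ z t < 0)) :
    Filter.Tendsto x Filter.atTop (nhds 0) ∧
    Filter.Tendsto z Filter.atTop (nhds 0) ∧
    Filter.Tendsto v Filter.atTop (nhds 0) := by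
  have hxd : ∀ t > 0, HasDerivAt x (v t) t := fun t ht =>
    (hx t (mem_Ici.2 ht.le)).hasDerivAt (Ici_mem_nhds ht)
  have hzd : ∀ t > 0, HasDerivAt z (v t + f₁ (z t) * g₁ (v t) + f₂ (z t) * g₂ (v t)) t :=
    fun t ht => (hz t (mem_Ici.2 ht.le)).hasDerivAt (Ici_mem_nhds ht)
  have hvd : ∀ t > 0, HasDerivAt v (-h₁ (x t) - h₂ (z t) - c (x t) (z t) (v t)) t :=
    fun t ht => (hv t (mem_Ici.2 ht.le)).hasDerivAt (Ici_mem_nhds ht)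
  rcases hN with ⟨T, hT, hpos⟩ | ⟨T, hT, hneg⟩
  · refine tendsto_zero_of_pos hh₁lip.continuous hh₂lip.continuous hh₁mono hh₂mono hh₁0 hh₂0
      hclip.continuous hc0 hcv (fun t ht => hxd t (hT.trans_lt ht))
      (fun t ht => hzd t (hT.trans_lt ht)) (fun t ht hvt => ?_)
      (fun t ht => hvd t (hT.trans_lt ht)) hpos
    rcases hvt.eq_or_lt with h | h
    · simp [h, hg₁0, hg₂0]
    · obtain ⟨hg₁, hg₂⟩ := hgneg _ h
      rw [hg₁]
      nlinarith [(hfpos _ (hpos t ht).2).2]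
  · have key := tendsto_zero_of_pos (h₁ := fun y => -h₁ (-y)) (h₂ := fun y => -h₂ (-y))
      (c := fun x z v => -c (-x) (-z) (-v)) (x := fun t => -x t) (z := fun t => -z t)
      (v := fun t => -v t) (T := T)
      (hh₁lip.continuous.comp continuous_neg).neg (hh₂lip.continuous.comp continuous_neg).neg
      (fun a b hab => neg_lt_neg (hh₁mono (neg_lt_neg hab)))
      (fun a b hab => neg_lt_neg (hh₂mono (neg_lt_neg hab)))
      (by simp [hh₁0]) (by simp [hh₂0])
      (hclip.continuous.comp (continuous_neg (G := ℝ × ℝ × ℝ))).neg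
      (fun x z => by simp [hc0])
      (fun x z v => by simpa using hcv (-x) (-z) (-v))
      (fun t ht => (hxd t (hT.trans_lt ht)).neg) (fun t ht => (hzd t (hT.trans_lt ht)).neg)
      (fun t ht hvt => ?_)
      (fun t ht => (hvd t (hT.trans_lt ht)).neg.congr_deriv (by simp only [neg_neg]; ring))
      (fun t ht => ⟨neg_pos.2 (hneg t ht).1, neg_pos.2 (hneg t ht).2⟩)
    · simpa only [neg_neg, neg_zero] using And.intro key.1.neg (And.intro key.2.1.neg key.2.2.neg)
    · rcases (neg_nonpos.1 hvt).eq_or_lt with h | h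
      · simp [← h, hg₁0, hg₂0]
      · obtain ⟨hg₁, hg₂⟩ := hgpos _ h
        rw [hg₂]
        nlinarith [(hfneg _ (hneg t ht).2).1]
end

section
/- Let X = (x, z, v) : [0, +∞) → ℝ³ be a global solution of the oscillator. If X is eventually in N_nw (there exists T ≥ 0 with X(t) ∈ N_nw for all t > T), then there exists L ≥ 0 such that dist(X(t), A(L)) → 0 as t → +∞, where A(L) = {(x, z, v) ∈ ℝ³ : z = x + L and v = 0}. If X is eventually in N_se, then there exists L ≤ 0 such that dist(X(t), A(L)) → 0 as t → +∞. -/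
open Set Filter Topology

/-- Mean value inequality: a lower bound on the derivative bounds the increment from below. -/
lemma mul_sub_le_sub_of_hasDerivAt {f f' : ℝ → ℝ} {a b m : ℝ} (hab : a ≤ b)
    (hf : ∀ s ∈ Icc a b, HasDerivAt f (f' s) s) (hm : ∀ s ∈ Icc a b, m ≤ f' s) :
    m * (b - a) ≤ f b - f a := by
  refine (convex_Icc a b).mul_sub_le_image_sub_of_le_deriv
    (fun s hs => (hf s hs).continuousAt.continuousWithinAt)
    (fun s hs => (hf s (interior_subset hs)).differentiableAt.differentiableWithinAt)
    (fun s hs => ?_) a (left_mem_Icc.2 hab) b (right_mem_Icc.2 hab) hab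
  rw [(hf s (interior_subset hs)).deriv]
  exact hm s (interior_subset hs)

/-- Mean value inequality: an upper bound on the derivative bounds the increment from above. -/
lemma sub_le_mul_sub_of_hasDerivAt {f f' : ℝ → ℝ} {a b m : ℝ} (hab : a ≤ b)
    (hf : ∀ s ∈ Icc a b, HasDerivAt f (f' s) s) (hm : ∀ s ∈ Icc a b, f' s ≤ m) :
    f b - f a ≤ m * (b - a) := by
  have := mul_sub_le_sub_of_hasDerivAt (f := fun s => -f s) (f' := fun s => -f' s) (m := -m) hab
    (fun s hs => (hf s hs).neg) (fun s hs => neg_le_neg (hm s hs))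
  linarith

/-- A function that is antitone and bounded below on `[T, ∞)` converges to a lower bound. -/
lemma AntitoneOn.exists_tendsto_atTop {w : ℝ → ℝ} {T b : ℝ} (hw : AntitoneOn w (Ici T))
    (hb : ∀ t ≥ T, b ≤ w t) :
    ∃ L, b ≤ L ∧ (∀ t ≥ T, L ≤ w t) ∧ Tendsto w atTop (𝓝 L) := by
  have hbdd : BddBelow (range fun t => w (max t T)) :=
    ⟨b, by rintro _ ⟨t, rfl⟩; exact hb _ (le_max_right _ _)⟩
  have hanti : Antitone fun t => w (max t T) := fun s t hst =>
    hw (mem_Ici.2 (le_max_right _ _)) (mem_Ici.2 (le_max_right _ _)) (max_le_max_right T hst)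
  refine ⟨⨅ t, w (max t T), le_ciInf fun t => hb _ (le_max_right _ _), fun t ht => ?_, ?_⟩
  · simpa [max_eq_left ht] using ciInf_le hbdd t
  · refine (tendsto_atTop_ciInf hanti hbdd).congr' ?_
    filter_upwards [eventually_ge_atTop T] with t ht
    rw [max_eq_left ht]

/-- Along a solution whose energy is dissipated, bounded positions force a bounded velocity. -/
lemma exists_velocity_bound {h₁ h₂ x z v z' v' : ℝ → ℝ} {T C : ℝ}
    (hh₁ : Continuous h₁) (hh₂ : Continuous h₂)
    (hx : ∀ t ≥ T, HasDerivAt x (v t) t) (hz : ∀ t ≥ T, HasDerivAt z (z' t) t)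
    (hv : ∀ t ≥ T, HasDerivAt v (v' t) t)
    (hdiss : ∀ t ≥ T, h₁ (x t) * v t + h₂ (z t) * z' t + v t * v' t ≤ 0)
    (hxC : ∀ t ≥ T, |x t| ≤ C) (hzC : ∀ t ≥ T, |z t| ≤ C) :
    ∃ V, ∀ t ≥ T, |v t| ≤ V := by
  have hH (h : ℝ → ℝ) (hh : Continuous h) (y : ℝ) :
      HasDerivAt (fun y => ∫ s in (0:ℝ)..y, h s) (h y) y :=
    intervalIntegral.integral_hasDerivAt_right (hh.intervalIntegrable _ _)
      (hh.stronglyMeasurableAtFilter _ _) hh.continuousAt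
  have hbound (h : ℝ → ℝ) (hh : Continuous h) :
      ∃ B, ∀ y, |y| ≤ C → |∫ s in (0:ℝ)..y, h s| ≤ B := by
    obtain ⟨B, hB⟩ := (isCompact_Icc (a := -C) (b := C)).exists_bound_of_continuousOn
      (f := fun y => ∫ s in (0:ℝ)..y, h s)
      (fun y _ => (hH h hh y).continuousAt.continuousWithinAt)
    exact ⟨B, fun y hy => hB y (abs_le.1 hy)⟩
  obtain ⟨B₁, hB₁⟩ := hbound h₁ hh₁
  obtain ⟨B₂, hB₂⟩ := hbound h₂ hh₂
  refine ⟨√(2 * (B₁ + B₂) * 2 + v T ^ 2), fun t ht => Real.abs_le_sqrt ?_⟩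
  have hE := sub_le_mul_sub_of_hasDerivAt (m := 0) ht
    (f := fun t => (∫ s in (0:ℝ)..x t, h₁ s) + (∫ s in (0:ℝ)..z t, h₂ s) + v t ^ 2 / 2)
    (f' := fun t => h₁ (x t) * v t + h₂ (z t) * z' t + v t * v' t)
    (fun s hs => by
      have h1 := (hH h₁ hh₁ (x s)).comp s (hx s hs.1)
      have h2 := (hH h₂ hh₂ (z s)).comp s (hz s hs.1)
      have h3 := ((hv s hs.1).pow 2).div_const 2
      exact ((h1.add h2).add h3).congr_deriv (by norm_num; ring))
    (fun s hs => hdiss s hs.1)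
  have a1 := abs_le.1 (hB₁ _ (hxC t ht))
  have a2 := abs_le.1 (hB₂ _ (hzC t ht))
  have a3 := abs_le.1 (hB₁ _ (hxC T le_rfl))
  have a4 := abs_le.1 (hB₂ _ (hzC T le_rfl))
  simp only [zero_mul] at hE
  linarith

/-- A continuous function of `(z, v)` that is positive for `z > 0`, `v ≠ 0` is bounded away from
zero on bounded sets where `z` and `|v|` are bounded away from zero. -/
lemma exists_pos_lower_bound {φ : ℝ → ℝ → ℝ} (hφ : Continuous fun p : ℝ × ℝ => φ p.1 p.2)
    (hpos : ∀ z > 0, ∀ v ≠ 0, 0 < φ z v) {η ε C V : ℝ} (hη : 0 < η) (hε : 0 < ε) :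
    ∃ m > 0, ∀ z v, η ≤ z → z ≤ C → ε ≤ |v| → |v| ≤ V → m ≤ φ z v := by
  have hK : IsCompact (Icc η C ×ˢ (Icc (-V) V ∩ {v : ℝ | ε ≤ |v|})) :=
    isCompact_Icc.prod (isCompact_Icc.inter_right (isClosed_le continuous_const continuous_abs))
  obtain ⟨m, hm, hle⟩ := hK.exists_forall_le' hφ.continuousOn (a := 0) (by
    rintro ⟨z, v⟩ ⟨hz, -, hv⟩
    exact hpos z (hη.trans_le hz.1) v (abs_pos.1 (hε.trans_le hv)))
  exact ⟨m, hm, fun z v h1 h2 h3 h4 => hle (z, v) ⟨⟨h1, h2⟩, abs_le.1 h4, h3⟩⟩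

/-- If `z` satisfies `z' = x' - φ(z, x')` with `φ` positive off `x' = 0`, and `x < 0 < z`, then
`z - x` converges; if moreover `x'` is bounded and Lipschitz, it tends to zero. -/
lemma tendsto_velocity_zero {φ : ℝ → ℝ → ℝ} (hφ : Continuous fun p : ℝ × ℝ => φ p.1 p.2)
    (hpos : ∀ z > 0, ∀ v ≠ 0, 0 < φ z v) {x z v v' : ℝ → ℝ} {T L C V M : ℝ}
    (hx : ∀ t ≥ T, HasDerivAt x (v t) t) (hv : ∀ t ≥ T, HasDerivAt v (v' t) t)
    (hw : ∀ t ≥ T, HasDerivAt (fun t => z t - x t) (-φ (z t) (v t)) t)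
    (hanti : AntitoneOn (fun t => z t - x t) (Ici T))
    (hL : ∀ t ≥ T, L ≤ z t - x t) (hlim : Tendsto (fun t => z t - x t) atTop (𝓝 L))
    (hz0 : ∀ t ≥ T, 0 < z t) (hzC : ∀ t ≥ T, z t ≤ C)
    (hV : ∀ t ≥ T, |v t| ≤ V) (hM : ∀ t ≥ T, |v' t| ≤ M) :
    Tendsto v atTop (𝓝 0) := by
  have hM1 : 0 < |M| + 1 := by positivity
  have hlip : ∀ s ≥ T, ∀ t ≥ s, |v t - v s| ≤ (|M| + 1) * (t - s) := fun s hs t hst => by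
    have hb : ∀ r ∈ Icc s t, |v' r| ≤ |M| + 1 := fun r hr =>
      (hM r (hs.le.trans hr.1)).trans ((le_abs_self M).trans (by linarith))
    have h1 := mul_sub_le_sub_of_hasDerivAt hst (fun r hr => hv r (hs.le.trans hr.1))
      (fun r hr => (abs_le.1 (hb r hr)).1)
    have h2 := sub_le_mul_sub_of_hasDerivAt hst (fun r hr => hv r (hs.le.trans hr.1))
      (fun r hr => (abs_le.1 (hb r hr)).2)
    exact abs_le.2 ⟨by linarith, h2⟩
  rw [Metric.tendsto_atTop]
  intro ε₂ hε₂
  obtain ⟨ε, hε, rfl⟩ : ∃ ε > 0, ε₂ = 2 * ε := ⟨ε₂ / 2, by positivity, by ring⟩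
  obtain ⟨δ, hδ, hδM⟩ : ∃ δ > 0, (|M| + 1) * δ = ε := ⟨ε / (|M| + 1), by positivity, by field_simp⟩
  have hη : 0 < ε * δ / 4 := by positivity
  obtain ⟨m, hm, hφm⟩ := exists_pos_lower_bound hφ hpos (C := C) (V := V) hη hε
  obtain ⟨T₁, hT₁⟩ := (hlim.eventually_lt_const
    (show L < L + min (ε * δ / 4) (m * (δ / 2)) by
      have : 0 < min (ε * δ / 4) (m * (δ / 2)) := by positivity
      linarith)).exists_forall_of_atTop
  -- no interval of length `δ / 2` far out can carry the dissipation rate `m`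
  have hno : ∀ a ≥ T, a ≥ T₁ → (∀ s ∈ Icc a (a + δ / 2), ε * δ / 4 ≤ z s ∧ ε ≤ |v s|) →
      False := fun a ha ha₁ hs => by
    have h1 := sub_le_mul_sub_of_hasDerivAt (show a ≤ a + δ / 2 by linarith)
      (fun s hs => hw s (ha.le.trans hs.1)) (m := -m) (fun s hs' => neg_le_neg
        (hφm _ _ (hs s hs').1 (hzC s (ha.le.trans hs'.1)) (hs s hs').2
          (hV s (ha.le.trans hs'.1))))
    have h2 := hT₁ a ha₁
    have h3 := min_le_right (ε * δ / 4) (m * (δ / 2))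
    have h4 := hL (a + δ / 2) (by linarith)
    linarith
  refine ⟨max T T₁ + δ, fun t ht => ?_⟩
  have htT : T + δ ≤ t := le_trans (by gcongr; exact le_max_left _ _) ht
  have htT₁ : T₁ + δ ≤ t := le_trans (by gcongr; exact le_max_right _ _) ht
  rw [Real.dist_eq, sub_zero]
  by_contra! hlt
  rcases le_abs.1 hlt with hvt | hvt
  · have hge : ∀ s ∈ Icc t (t + δ), ε ≤ v s := fun s hs => by
      have h1 := (abs_le.1 (hlip t (by linarith) s hs.1)).1
      have h2 : (|M| + 1) * (s - t) ≤ (|M| + 1) * δ := by gcongr; linarith [hs.2]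
      linarith
    refine hno (t + δ / 2) (by linarith) (by linarith) fun s hs => ?_
    have hs1 : t + δ / 2 ≤ s := hs.1
    have hs2 : s ≤ t + δ := by linarith [hs.2]
    refine ⟨?_, (hge s ⟨by linarith, hs2⟩).trans (le_abs_self _)⟩
    have h1 := mul_sub_le_sub_of_hasDerivAt (show t ≤ s by linarith)
      (fun r hr => hx r (by linarith [hr.1])) (fun r hr => hge r ⟨hr.1, hr.2.trans hs2⟩)
    have h2 := hT₁ t (by linarith)
    have h3 := min_le_left (ε * δ / 4) (m * (δ / 2))
    have h4 := hL s (by linarith)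
    have h5 := hz0 t (by linarith)
    have h6 : ε * (δ / 2) ≤ ε * (s - t) := by gcongr; linarith
    linarith
  · have hle : ∀ s ∈ Icc (t - δ) t, v s ≤ -ε := fun s hs => by
      have h1 := (abs_le.1 (hlip s (by linarith [hs.1]) t hs.2)).1
      have h2 : (|M| + 1) * (t - s) ≤ (|M| + 1) * δ := by gcongr; linarith [hs.1]
      linarith
    refine hno (t - δ) (by linarith) (by linarith) fun s hs => ?_
    have hs1 : t - δ ≤ s := hs.1
    have hs2 : s ≤ t - δ / 2 := by linarith [hs.2]
    refine ⟨?_, by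
      have := hle s ⟨hs1, by linarith⟩
      exact le_trans (by linarith) (neg_le_abs _)⟩
    have h1 := sub_le_mul_sub_of_hasDerivAt (show s ≤ t by linarith)
      (fun r hr => hx r (by linarith [hr.1])) (fun r hr => hle r ⟨hs1.trans hr.1, hr.2⟩)
    have h4 := hanti (show s ∈ Ici T from by simp only [mem_Ici]; linarith)
      (show t ∈ Ici T from by simp only [mem_Ici]; linarith) (show s ≤ t by linarith)
    have h5 := hz0 t (by linarith)
    have h6 : ε * (δ / 2) ≤ ε * (t - s) := by gcongr; linarith
    simp only at h4
    linarith

/-- A solution of the oscillator with `x < 0 < z` has convergent `z - x` and vanishing velocity. -/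
lemma exists_tendsto_of_neg_of_pos {φ : ℝ → ℝ → ℝ} {h₁ h₂ : ℝ → ℝ} {c : ℝ → ℝ → ℝ → ℝ}
    (hφ : Continuous fun p : ℝ × ℝ => φ p.1 p.2)
    (hnonneg : ∀ z > 0, ∀ v, 0 ≤ φ z v) (hpos : ∀ z > 0, ∀ v ≠ 0, 0 < φ z v)
    (hh₁ : Continuous h₁) (hh₂ : Continuous h₂) (hh₂pos : ∀ z > 0, 0 ≤ h₂ z)
    (hc : Continuous fun p : ℝ × ℝ × ℝ => c p.1 p.2.1 p.2.2)
    (hcv : ∀ x z v : ℝ, 0 ≤ v * c x z v) {x z v : ℝ → ℝ} {T : ℝ}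
    (hx : ∀ t ≥ T, HasDerivAt x (v t) t)
    (hz : ∀ t ≥ T, HasDerivAt z (v t - φ (z t) (v t)) t)
    (hv : ∀ t ≥ T, HasDerivAt v (-h₁ (x t) - h₂ (z t) - c (x t) (z t) (v t)) t)
    (hx0 : ∀ t ≥ T, x t < 0) (hz0 : ∀ t ≥ T, 0 < z t) :
    ∃ L, 0 ≤ L ∧ Tendsto (fun t => z t - x t) atTop (𝓝 L) ∧ Tendsto v atTop (𝓝 0) := by
  have hw : ∀ t ≥ T, HasDerivAt (fun t => z t - x t) (-φ (z t) (v t)) t := fun t ht =>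
    ((hz t ht).sub (hx t ht)).congr_deriv (by ring)
  have hanti : AntitoneOn (fun t => z t - x t) (Ici T) := fun s hs t _ hst => by
    have := sub_le_mul_sub_of_hasDerivAt (m := 0) hst
      (fun r hr => hw r (le_trans hs hr.1))
      (fun r hr => neg_nonpos.2 (hnonneg _ (hz0 r (le_trans hs hr.1)) _))
    simp only at this ⊢
    linarith
  obtain ⟨L, hL0, hL, hlim⟩ := hanti.exists_tendsto_atTop (b := 0)
    (fun t ht => by linarith [hx0 t ht, hz0 t ht])
  refine ⟨L, hL0, hlim, ?_⟩
  have hle : ∀ t ≥ T, z t - x t ≤ z T - x T := fun t ht =>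
    hanti (mem_Ici.2 le_rfl) (mem_Ici.2 ht) ht
  have hzC : ∀ t ≥ T, |z t| ≤ z T - x T := fun t ht => by
    rw [abs_of_pos (hz0 t ht)]; linarith [hle t ht, hx0 t ht]
  have hxC : ∀ t ≥ T, |x t| ≤ z T - x T := fun t ht => by
    rw [abs_of_neg (hx0 t ht)]; linarith [hle t ht, hz0 t ht]
  obtain ⟨V, hV⟩ := exists_velocity_bound hh₁ hh₂ hx hz hv (fun t ht => by
    have h1 := mul_nonneg (hh₂pos _ (hz0 t ht)) (hnonneg _ (hz0 t ht) (v t))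
    have h2 := hcv (x t) (z t) (v t)
    linarith) hxC hzC
  obtain ⟨M, hM⟩ := ((isCompact_Icc (a := -(z T - x T)) (b := z T - x T)).prod
    ((isCompact_Icc (a := -(z T - x T)) (b := z T - x T)).prod
      (isCompact_Icc (a := -V) (b := V)))).exists_bound_of_continuousOn
    (f := fun p : ℝ × ℝ × ℝ => -h₁ p.1 - h₂ p.2.1 - c p.1 p.2.1 p.2.2)
    (by fun_prop)
  exact tendsto_velocity_zero hφ hpos hx hv hw hanti hL hlim hz0
    (fun t ht => (le_abs_self _).trans (hzC t ht)) hV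
    (fun t ht => hM (x t, z t, v t)
      ⟨abs_le.1 (hxC t ht), abs_le.1 (hzC t ht), abs_le.1 (hV t ht)⟩)

/-- If `z - x → L` and `v → 0`, then the distance to `{z = x + L, v = 0}` tends to zero. -/
lemma tendsto_sInf_dist_zero {x z v : ℝ → ℝ} {L : ℝ}
    (hw : Tendsto (fun t => z t - x t) atTop (𝓝 L)) (hv : Tendsto v atTop (𝓝 0)) :
    Tendsto (fun t => sInf {d : ℝ | ∃ a : ℝ,
      d = Real.sqrt ((x t - a) ^ 2 + (z t - (a + L)) ^ 2 + (v t) ^ 2)}) atTop (𝓝 0) := by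
  have hlim : Tendsto (fun t => √((z t - x t - L) ^ 2 + v t ^ 2)) atTop (𝓝 0) := by
    have := (((hw.sub_const L).pow 2).add (hv.pow 2)).sqrt
    simpa using this
  refine squeeze_zero (fun t => Real.sInf_nonneg ?_) (fun t => csInf_le ⟨0, ?_⟩ ⟨x t, ?_⟩) hlim
  · rintro _ ⟨a, rfl⟩
    exact Real.sqrt_nonneg _
  · rintro _ ⟨a, rfl⟩
    exact Real.sqrt_nonneg _
  · congr 1
    ring

/-- If a global solution of the oscillator is eventually in `N_nw`, then it
converges to `A(L) = {(x, z, v) : z = x + L ∧ v = 0}` for some `L ≥ 0`;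
if it is eventually in `N_se`, then it converges to `A(L)` for some `L ≤ 0`. -/
theorem eventually_Nnw_or_Nse_tendsto_A
    (f₁ f₂ g₁ g₂ h₁ h₂ : ℝ → ℝ) (c : ℝ → ℝ → ℝ → ℝ)
    (hf₁lip : LocallyLipschitz f₁) (hf₂lip : LocallyLipschitz f₂)
    (hg₁lip : LocallyLipschitz g₁) (hg₂lip : LocallyLipschitz g₂)
    (hh₁lip : LocallyLipschitz h₁) (hh₂lip : LocallyLipschitz h₂)
    (hh₁mono : StrictMono h₁) (hh₂mono : StrictMono h₂)
    (hf₁0 : f₁ 0 = 0) (hf₂0 : f₂ 0 = 0) (hg₁0 : g₁ 0 = 0) (hg₂0 : g₂ 0 = 0)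
    (hh₁0 : h₁ 0 = 0) (hh₂0 : h₂ 0 = 0)
    (hfneg : ∀ z < (0:ℝ), 0 < f₁ z ∧ f₂ z < 0)
    (hfpos : ∀ z > (0:ℝ), f₁ z < 0 ∧ 0 < f₂ z)
    (hgpos : ∀ v > (0:ℝ), 0 < g₁ v ∧ g₂ v = 0)
    (hgneg : ∀ v < (0:ℝ), g₁ v = 0 ∧ g₂ v < 0)
    (hclip : LocallyLipschitz (fun p : ℝ × ℝ × ℝ => c p.1 p.2.1 p.2.2))
    (hc0 : ∀ x z : ℝ, c x z 0 = 0)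
    (hcv : ∀ x z v : ℝ, 0 ≤ v * c x z v)
    (x z v : ℝ → ℝ)
    (hx : ∀ t ∈ Set.Ici (0:ℝ), HasDerivWithinAt x (v t) (Set.Ici 0) t)
    (hz : ∀ t ∈ Set.Ici (0:ℝ), HasDerivWithinAt z
      (v t + f₁ (z t) * g₁ (v t) + f₂ (z t) * g₂ (v t)) (Set.Ici 0) t)
    (hv : ∀ t ∈ Set.Ici (0:ℝ), HasDerivWithinAt v
      (-h₁ (x t) - h₂ (z t) - c (x t) (z t) (v t)) (Set.Ici 0) t)
    :
    ((∃ T ≥ (0:ℝ), ∀ t > T, x t < 0 ∧ 0 < z t) →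
      ∃ L : ℝ, 0 ≤ L ∧
        Filter.Tendsto (fun t => sInf {d : ℝ | ∃ a : ℝ,
            d = Real.sqrt ((x t - a) ^ 2 + (z t - (a + L)) ^ 2 + (v t) ^ 2)})
          Filter.atTop (nhds 0)) ∧
    ((∃ T ≥ (0:ℝ), ∀ t > T, 0 < x t ∧ z t < 0) →
      ∃ L : ℝ, L ≤ 0 ∧
        Filter.Tendsto (fun t => sInf {d : ℝ | ∃ a : ℝ,
            d = Real.sqrt ((x t - a) ^ 2 + (z t - (a + L)) ^ 2 + (v t) ^ 2)})
          Filter.atTop (nhds 0)) := by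
  have hderiv {y : ℝ → ℝ} {y' t T : ℝ} (hT : 0 ≤ T) (ht : t ≥ T + 1)
      (h : HasDerivWithinAt y y' (Set.Ici 0) t) : HasDerivAt y y' t :=
    h.hasDerivAt (Ici_mem_nhds (by linarith))
  have cf₁ := hf₁lip.continuous
  have cf₂ := hf₂lip.continuous
  have cg₁ := hg₁lip.continuous
  have cg₂ := hg₂lip.continuous
  have ch₁ := hh₁lip.continuous
  have ch₂ := hh₂lip.continuous
  have cc := hclip.continuous
  have hpos : ∀ z > 0, ∀ v ≠ 0, 0 < -(f₁ z * g₁ v + f₂ z * g₂ v) := by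
    intro z hz v hv
    rcases lt_or_gt_of_ne hv with hv | hv
    · rw [(hgneg v hv).1]
      linarith [mul_neg_of_pos_of_neg (hfpos z hz).2 (hgneg v hv).2]
    · rw [(hgpos v hv).2]
      linarith [mul_neg_of_neg_of_pos (hfpos z hz).1 (hgpos v hv).1]
  have hpos' : ∀ z > 0, ∀ v ≠ 0, 0 < f₁ (-z) * g₁ (-v) + f₂ (-z) * g₂ (-v) := by
    intro z hz v hv
    have hf := hfneg (-z) (by linarith)
    rcases lt_or_gt_of_ne hv with hv | hv
    · have hg := hgpos (-v) (by linarith)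
      rw [hg.2]
      linarith [mul_pos hf.1 hg.1]
    · have hg := hgneg (-v) (by linarith)
      rw [hg.1]
      linarith [mul_pos_of_neg_of_neg hf.2 hg.2]
  constructor
  · rintro ⟨T, hT, hN⟩
    obtain ⟨L, hL, hw, hv0⟩ := exists_tendsto_of_neg_of_pos (T := T + 1)
      (φ := fun z v => -(f₁ z * g₁ v + f₂ z * g₂ v)) (by fun_prop)
      (fun z hz v => by
        rcases eq_or_ne v 0 with rfl | hv
        · simp [hg₁0, hg₂0]
        · exact (hpos z hz v hv).le)
      hpos ch₁ ch₂ (fun z hz => hh₂0 ▸ (hh₂mono hz).le) cc hcv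
      (fun t ht => hderiv hT ht (hx t (by simp only [mem_Ici]; linarith)))
      (fun t ht => by
        convert hderiv hT ht (hz t (by simp only [mem_Ici]; linarith)) using 1
        ring)
      (fun t ht => hderiv hT ht (hv t (by simp only [mem_Ici]; linarith)))
      (fun t ht => (hN t (by linarith)).1) (fun t ht => (hN t (by linarith)).2)
    exact ⟨L, hL, tendsto_sInf_dist_zero hw hv0⟩
  · rintro ⟨T, hT, hN⟩
    obtain ⟨L, hL, hw, hv0⟩ := exists_tendsto_of_neg_of_pos (T := T + 1)
      (x := fun t => -x t) (z := fun t => -z t) (v := fun t => -v t)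
      (φ := fun z v => f₁ (-z) * g₁ (-v) + f₂ (-z) * g₂ (-v))
      (h₁ := fun y => -h₁ (-y)) (h₂ := fun y => -h₂ (-y))
      (c := fun x z v => -c (-x) (-z) (-v)) (by fun_prop)
      (fun z hz v => by
        rcases eq_or_ne v 0 with rfl | hv
        · simp [hg₁0, hg₂0]
        · exact (hpos' z hz v hv).le)
      hpos' (by fun_prop) (by fun_prop)
      (fun z hz => by
        have := hh₂mono (show -z < 0 by linarith)
        linarith)
      (cc.comp (show Continuous fun p : ℝ × ℝ × ℝ => (-p.1, -p.2.1, -p.2.2) by fun_prop)).neg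
      (fun x z v => by linarith [hcv (-x) (-z) (-v)])
      (fun t ht => (hderiv hT ht (hx t (by simp only [mem_Ici]; linarith))).neg)
      (fun t ht =>
        (hderiv hT ht (hz t (by simp only [mem_Ici]; linarith))).neg.congr_deriv
          (by simp only [neg_neg]; ring))
      (fun t ht =>
        (hderiv hT ht (hv t (by simp only [mem_Ici]; linarith))).neg.congr_deriv
          (by simp only [neg_neg]; ring))
      (fun t ht => neg_neg_of_pos (hN t (by linarith)).1)
      (fun t ht => neg_pos_of_neg (hN t (by linarith)).2)
    refine ⟨-L, by linarith, tendsto_sInf_dist_zero ?_ (by simpa using hv0.neg)⟩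
    exact hw.neg.congr fun t => by ring
end
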